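/- arXiv:1601.07304 — 4 statements merged into one kernel-verified Lean document; each statement's English description precedes it below -/
import Mathlib

section
/- Let M be a countably infinite structure over a finite relational vocabulary which is model-complete and ω-categorical. Then Age(M) satisfies SEAP if and only if M is homogenizable. -/
open FirstOrder FirstOrder.Language CategoryTheory

namespace HomPaper

/-- The language consisting of `n` new relation symbols, the `i`-th of arity `k i`. -/
def expLang (n : ℕ) (k : Fin n → ℕ) : FirstOrder.Language.{0, 0} where
  Functions := fun _ => Empty
  Relations := fun m => {i : Fin n // k i = m}

variable (L : FirstOrder.Language.{0, 0})

/-- The interpretation of the new relation symbols: the `i`-th symbol is interpreted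
by the set defined by the formula `φ i`. -/
def expStructure (M : Type) [L.Structure M] {n : ℕ} {k : Fin n → ℕ}
    (φ : ∀ i : Fin n, L.Formula (Fin (k i))) : (expLang n k).Structure M where
  funMap := fun f _ => f.elim
  RelMap := fun {m} r x => (φ r.1).Realize (x ∘ Fin.cast r.2)

/-- `φ` is a family of homogenizing formulas for `M`: the expansion of `M` by new relation
symbols interpreted by the sets defined by the `φ i` is a homogeneous structure. -/
def Homogenizes (M : Type) [L.Structure M] {n : ℕ} {k : Fin n → ℕ}
    (φ : ∀ i : Fin n, L.Formula (Fin (k i))) : Prop :=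
  letI : (expLang n k).Structure M := expStructure L M φ
  (L.sum (expLang n k)).IsUltrahomogeneous M

/-- `M` is homogenizable. -/
def Homogenizable (M : Type) [L.Structure M] : Prop :=
  ∃ (n : ℕ) (k : Fin n → ℕ) (φ : ∀ i : Fin n, L.Formula (Fin (k i))),
    Homogenizes L M φ

/-- A `Σ₁`-formula: an existentially quantified quantifier-free formula. -/
def IsSigma1 {α : Type} (φ : L.Formula α) : Prop :=
  ∃ (m : ℕ) (ψ : L.BoundedFormula α m), ψ.IsQF ∧ φ = ψ.exs

/-- `M` is `Σ₁`-homogenizable: homogenizable with `Σ₁` homogenizing formulas. -/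
def Sigma1Homogenizable (M : Type) [L.Structure M] : Prop :=
  ∃ (n : ℕ) (k : Fin n → ℕ) (φ : ∀ i : Fin n, L.Formula (Fin (k i))),
    (∀ i, IsSigma1 L (φ i)) ∧ Homogenizes L M φ

/-- `M` is unary homogenizable: homogenizable with homogenizing formulas having
exactly one free variable. -/
def UnaryHomogenizable (M : Type) [L.Structure M] : Prop :=
  ∃ (n : ℕ) (φ : ∀ _ : Fin n, L.Formula (Fin 1)),
    Homogenizes L M (k := fun _ => 1) φ

/-- Two tuples have the same complete type over `∅`. -/
def SameType (M : Type) [L.Structure M] {m : ℕ} (a b : Fin m → M) : Prop :=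
  ∀ φ : L.Formula (Fin m), φ.Realize a ↔ φ.Realize b

/-- The complete type of the tuple `a` over `∅` is isolated by a quantifier-free formula. -/
def QFIsolated (M : Type) [L.Structure M] {m : ℕ} (a : Fin m → M) : Prop :=
  ∃ φ : L.Formula (Fin m), φ.IsQF ∧ φ.Realize a ∧
    ∀ b : Fin m → M, φ.Realize b → SameType L M a b

/-- `M` is boundedly homogenizable. -/
def BoundedlyHomogenizable (M : Type) [L.Structure M] : Prop :=
  Homogenizable L M ∧
    ∀ (p : ℕ) (a : Fin p → M), ∃ (q : ℕ) (b : Fin q → M),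
      QFIsolated L M (Fin.append a b)

/-- `M` is uniformly homogenizable. -/
def UniformlyHomogenizable (M : Type) [L.Structure M] : Prop :=
  Homogenizable L M ∧
    ∃ (p : ℕ) (a : Fin p → M), ∀ (q : ℕ) (b : Fin q → M),
      QFIsolated L M (Fin.append a b)

/-- `M` is `k`-unavoidably homogenizable: every complete `n`-type with `n ≥ k` is isolated by
a quantifier-free formula. -/
def KUnavoidablyHomogenizable (M : Type) [L.Structure M] (k : ℕ) : Prop :=
  ∀ n : ℕ, k ≤ n → ∀ a : Fin n → M, QFIsolated L M a

/-- `M` is unavoidably homogenizable. -/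
def UnavoidablyHomogenizable (M : Type) [L.Structure M] : Prop :=
  ∃ k : ℕ, KUnavoidablyHomogenizable L M k

/-- The age of `M`: the class of all finite structures embeddable into `M`
(i.e. all finite substructures of `M`, up to isomorphism). -/
def FinAge (M : Type) [L.Structure M] : Set (Bundled.{0} L.Structure) :=
  {N | Finite N ∧ Nonempty (N ↪[L] M)}

/-- The pair of embeddings `f`, `g` has an amalgam in the class `K`. -/
def HasAmalgam (K : Set (Bundled.{0} L.Structure)) {A B C : Type}
    [L.Structure A] [L.Structure B] [L.Structure C]
    (f : A ↪[L] B) (g : A ↪[L] C) : Prop :=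
  ∃ D ∈ K, ∃ (f0 : B ↪[L] D) (g0 : C ↪[L] D), ∀ x : A, f0 (f x) = g0 (g x)

/-- `A` is an amalgamation base for the class `K`. -/
def IsAmalgamationBase (K : Set (Bundled.{0} L.Structure)) (A : Type) [L.Structure A] : Prop :=
  ∀ B C : Bundled.{0} L.Structure, B ∈ K → C ∈ K →
    ∀ (f : A ↪[L] B) (g : A ↪[L] C), HasAmalgam L K f g

/-- The class `K` satisfies `SEAP_{k,m}`. -/
def SEAPAt (K : Set (Bundled.{0} L.Structure)) (k m : ℕ) : Prop :=
  ∀ A B C : Bundled.{0} L.Structure, A ∈ K → B ∈ K → C ∈ K →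
    ∀ (f : A ↪[L] B) (g : A ↪[L] C), ¬ HasAmalgam L K f g →
      ∃ A0 : L.Substructure A, Nat.card A0 < k ∧
      ∃ B0 ∈ K, ∃ C0 ∈ K, ∃ (eB : B ↪[L] B0) (eC : C ↪[L] C0),
        Nat.card B0 - Nat.card B < m ∧ Nat.card C0 - Nat.card C < m ∧
        ¬ HasAmalgam L K ((eB.comp f).comp A0.subtype) ((eC.comp g).comp A0.subtype)

/-- The class `K` satisfies SEAP. -/
def SEAP (K : Set (Bundled.{0} L.Structure)) : Prop :=
  ∃ k m : ℕ, SEAPAt L K k m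

/-- `M` is ω-categorical: `Th(M)` has exactly one countable model up to isomorphism. -/
def OmegaCategorical (M : Type) [L.Structure M] : Prop :=
  ∀ N₁ N₂ : ((L.completeTheory M).ModelType : Type 1),
    Countable N₁ → Countable N₂ → Nonempty (N₁ ≃[L] N₂)

/-- `M` is model-complete: every embedding between models of `Th(M)` is elementary. -/
def ModelComplete (M : Type) [L.Structure M] : Prop :=
  ∀ (N₁ N₂ : ((L.completeTheory M).ModelType : Type 1)) (f : N₁ ↪[L] N₂)
    (p : ℕ) (φ : L.Formula (Fin p)) (x : Fin p → N₁),
    φ.Realize (fun i => f (x i)) ↔ φ.Realize x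


/-- `M` is ω-saturated: every type over a finite tuple of parameters from `M` which is
consistent with `Th(M)` (equivalently, finitely realized in `M`) is realized in `M`. -/
def OmegaSaturated (M : Type) [L.Structure M] : Prop :=
  ∀ (p : ℕ) (c : Fin p → M) (S : Set (L.Formula (Fin (p + 1)))),
    (∀ s : Finset (L.Formula (Fin (p + 1))), ↑s ⊆ S →
      ∃ a : M, ∀ φ ∈ s, φ.Realize (Fin.snoc c a)) →
    ∃ a : M, ∀ φ ∈ S, φ.Realize (Fin.snoc c a)

/-- `M` is ω-stable: over every countable parameter set there are at most countably many
complete types. -/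
def OmegaStable (M : Type) [L.Structure M] : Prop :=
  ∀ A : Set M, A.Countable →
    ∀ p : ℕ, Countable ((L[[↥A]].completeTheory M).CompleteType (Fin p))

/-- The complete type of `a` is isolated by a conjunction of (relabelings of) the
homogenizing formulas `φ` and quantifier-free formulas. -/
def IsolatedByHomConj (M : Type) [L.Structure M] {n : ℕ} {k : Fin n → ℕ}
    (φ : ∀ i : Fin n, L.Formula (Fin (k i))) {p : ℕ} (a : Fin p → M) : Prop :=
  ∃ ψ : L.Formula (Fin p), ψ.IsQF ∧
    ∃ ts : List (Σ i : Fin n, Fin (k i) → Fin p),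
      (ψ.Realize a ∧ ∀ t ∈ ts, ((φ t.1).relabel t.2).Realize a) ∧
      ∀ b : Fin p → M,
        (ψ.Realize b ∧ ∀ t ∈ ts, ((φ t.1).relabel t.2).Realize b) → SameType L M a b

/-- `a` and `b` realize the same type over the parameter set `X`. -/
def EqTypeOver (M : Type) [L.Structure M] (X : Set M) (a b : M) : Prop :=
  ∀ (p : ℕ) (c : Fin p → M), Set.range c ⊆ X →
    ∀ φ : L.Formula (Fin (p + 1)), φ.Realize (Fin.snoc c a) ↔ φ.Realize (Fin.snoc c b)

/-- The algebraic closure in `M` is degenerate: `acl(X) = X` for every `X ⊆ M`. -/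
def DegenerateAcl (M : Type) [L.Structure M] : Prop :=
  ∀ (X : Set M) (a : M), {b : M | EqTypeOver L M X a b}.Finite → a ∈ X

/-- The induced structure on a subset of a structure for a relational language. -/
def inducedStructure (M : Type) [L.Structure M] [L.IsRelational] (A : Set M) :
    L.Structure A where
  funMap := fun f _ => isEmptyElim f
  RelMap := fun r x => Structure.RelMap r fun i => (x i : M)

/-- Elements `a` and `b` satisfy the same atomic formulas in one free variable
(the same atomic diagram). -/
def SameAtomic1 (M : Type) [L.Structure M] (a b : M) : Prop :=
  ∀ φ : L.Formula (Fin 1), φ.IsAtomic →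
    (φ.Realize (fun _ => a) ↔ φ.Realize (fun _ => b))

/-- `M` has uniformly homogenizing formulas. -/
def HasUniformlyHomogenizingFormulas (M : Type) [L.Structure M] : Prop :=
  ∃ (n : ℕ) (k m : Fin n → ℕ)
    (ψ : ∀ i : Fin n, L.BoundedFormula (Fin (k i)) (m i)),
    (∀ i, (ψ i).IsQF) ∧ Homogenizes L M (fun i => (ψ i).exs) ∧
    ∀ i, ∃ w : Fin (m i) → M, ∀ y : Fin (k i) → M,
      (∃ w0 : Fin (m i) → M, (ψ i).Realize y w0) → (ψ i).Realize y w

end HomPaper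


namespace HomPaper

section TypesOfTuples

variable {L : FirstOrder.Language.{0, 0}} {M : Type} [L.Structure M] {α β : Type}

/-- Tuples indexed by an arbitrary type have the same complete type over `∅`. -/
def EqType (L : FirstOrder.Language.{0, 0}) {M : Type} [L.Structure M] {α : Type}
    (a b : α → M) : Prop :=
  ∀ φ : L.Formula α, φ.Realize a ↔ φ.Realize b

/-- The complete type over `∅` of the tuple `a` is isolated in `M`. -/
def IsIsolated (L : FirstOrder.Language.{0, 0}) {M : Type} [L.Structure M] {α : Type}
    (a : α → M) : Prop :=
  ∃ φ : L.Formula α, φ.Realize a ∧ ∀ b, φ.Realize b → EqType L a b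

theorem EqType.symm {a b : α → M} (h : EqType L a b) : EqType L b a := fun φ => (h φ).symm

theorem EqType.trans {a b c : α → M} (h : EqType L a b) (h' : EqType L b c) : EqType L a c :=
  fun φ => (h φ).trans (h' φ)

theorem EqType.comp {a b : α → M} (h : EqType L a b) (σ : β → α) : EqType L (a ∘ σ) (b ∘ σ) :=
  fun φ => by simpa only [Formula.realize_relabel] using h (φ.relabel σ)

theorem exists_formula_realize_iff_exists_comp [Finite α] [Finite β] (φ : L.Formula β)
    (σ : α → β) : ∃ ψ : L.Formula α, ∀ a : α → M, ψ.Realize a ↔ ∃ c, φ.Realize c ∧ c ∘ σ = a := by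
  have h : (∅ : Set M).Definable L {c | φ.Realize c} := Set.empty_definable_iff.2 ⟨φ, rfl⟩
  obtain ⟨ψ, hψ⟩ := Set.empty_definable_iff.1 (h.image_comp σ)
  exact ⟨ψ, fun a => (Set.ext_iff.1 hψ a).symm⟩

theorem IsIsolated.congr {a b : α → M} (h : IsIsolated L a) (hab : EqType L a b) :
    IsIsolated L b := by
  obtain ⟨φ, hφ, hφ'⟩ := h
  exact ⟨φ, (hab φ).1 hφ, fun c hc => hab.symm.trans (hφ' c hc)⟩

theorem IsIsolated.comp [Finite α] [Finite β] {c : β → M} (hc : IsIsolated L c) (σ : α → β) :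
    IsIsolated L (c ∘ σ) := by
  obtain ⟨φ, hφ, hφ'⟩ := hc
  obtain ⟨ψ, hψ⟩ := exists_formula_realize_iff_exists_comp (M := M) φ σ
  refine ⟨ψ, (hψ _).2 ⟨c, hφ, rfl⟩, fun b hb => ?_⟩
  obtain ⟨d, hd, rfl⟩ := (hψ _).1 hb
  exact (hφ' d hd).comp σ

theorem IsIsolated.of_range_subset [Finite α] [Finite β] {c : β → M} (hc : IsIsolated L c)
    {a : α → M} (h : ∀ i, ∃ j, c j = a i) : IsIsolated L a := by
  choose σ hσ using h
  obtain rfl : c ∘ σ = a := funext hσ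
  exact hc.comp σ

/-- A tuple of isolated type may be moved along an equality of types of a subtuple. -/
theorem IsIsolated.exists_eqType_comp_eq [Finite α] [Finite β] {c : β → M}
    (hc : IsIsolated L c) {σ : α → β} {b : α → M} (h : EqType L (c ∘ σ) b) :
    ∃ c', EqType L c c' ∧ c' ∘ σ = b := by
  obtain ⟨φ, hφ, hφ'⟩ := hc
  obtain ⟨ψ, hψ⟩ := exists_formula_realize_iff_exists_comp (M := M) φ σ
  obtain ⟨d, hd, hdb⟩ := (hψ b).1 ((h ψ).1 ((hψ _).2 ⟨c, hφ, rfl⟩))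
  exact ⟨d, hφ' d hd, hdb⟩

end TypesOfTuples

section Categorical

variable {L : FirstOrder.Language.{0, 0}} {M : Type} [L.Structure M] {α β : Type}

theorem exists_equiv_of_elementarilyEquivalent [Countable M] [Nonempty M]
    (hcat : OmegaCategorical L M) (N : Type) [L.Structure N] [Countable N] [Nonempty N]
    [N ⊨ L.completeTheory M] : Nonempty (M ≃[L] N) :=
  hcat (Theory.ModelType.of _ M) (Theory.ModelType.of _ N) ‹_› ‹_›

/-- The countable model of an `ω`-categorical theory realizes every finitely satisfiable set of
formulas in countably many variables. -/
theorem OmegaCategorical.exists_realize_of_finset [Countable L.Symbols] [Countable M] [Infinite M]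
    (hcat : OmegaCategorical L M) [Countable α] {ι : Type} (Θ : ι → L.Formula α)
    (h : ∀ s : Finset ι, ∃ v : α → M, ∀ i ∈ s, (Θ i).Realize v) :
    ∃ v : α → M, ∀ i, (Θ i).Realize v := by
  classical
  let T : Option ι → L[[α]].Theory := fun o =>
    o.elim ((L.lhomWithConstants α).onTheory (L.completeTheory M))
      fun i => {Formula.equivSentence (Θ i)}
  let U : L[[α]].Theory := ⋃ o, T o
  have hsat : U.IsSatisfiable := by
    rw [Theory.isSatisfiable_iUnion_iff_isSatisfiable_iUnion_finset]
    intro s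
    obtain ⟨v, hv⟩ := h s.eraseNone
    let : (constantsOn α).Structure M := constantsOn.structure v
    have : M ⊨ ⋃ o ∈ s, T o := by
      refine ⟨fun φ hφ => ?_⟩
      obtain ⟨o, ho, hφ⟩ := Set.mem_iUnion₂.1 hφ
      cases o with
      | none =>
        have : M ⊨ (L.lhomWithConstants α).onTheory (L.completeTheory M) :=
          (LHom.onTheory_model _ _).2 inferInstance
        exact this.realize_of_mem φ hφ
      | some i =>
        obtain rfl : φ = Formula.equivSentence (Θ i) := hφ
        exact (Formula.realize_equivSentence _ _).2 (hv i (Finset.mem_eraseNone.2 ho))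
    exact Theory.Model.isSatisfiable M
  have hmod (N : U.ModelType) :
      N ⊨ (L.lhomWithConstants α).onTheory (L.completeTheory M) :=
    Theory.Model.mono N.is_model (Set.subset_iUnion T none)
  have hinf : ∃ N : U.ModelType, Infinite N := by
    obtain ⟨N⟩ := hsat
    refine ⟨N, ?_⟩
    let := (L.lhomWithConstants α).reduct N
    have : N ⊨ L.completeTheory M := (LHom.onTheory_model (L.lhomWithConstants α) _).1 (hmod N)
    have h : M ≅[L] N :=
      elementarilyEquivalent_iff.2 fun φ => (realize_iff_of_model_completeTheory M N φ).symm
    exact h.infinite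
  obtain ⟨N, hN⟩ := Theory.exists_model_card_eq hinf Cardinal.aleph0.{0} le_rfl (by
    rw [Cardinal.lift_id, Cardinal.lift_id]
    exact Cardinal.mk_le_aleph0 (α := L[[α]].Symbols))
  let := (L.lhomWithConstants α).reduct N
  have : N ⊨ L.completeTheory M := (LHom.onTheory_model (L.lhomWithConstants α) _).1 (hmod N)
  have : Countable N := Cardinal.mk_le_aleph0_iff.1 hN.le
  obtain ⟨e⟩ := exists_equiv_of_elementarilyEquivalent hcat N
  refine ⟨fun i => e.symm (L.con i : N), fun i => ?_⟩
  have h1 : (Formula.equivSentence (Θ i)).Realize N :=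
    N.is_model.realize_of_mem _ (Set.mem_iUnion.2 ⟨some i, rfl⟩)
  exact (StrongHomClass.realize_formula e.symm (Θ i)).2 ((Formula.realize_equivSentence _ _).1 h1)

theorem OmegaCategorical.exists_isIsolated [Countable L.Symbols] [Countable M] [Infinite M]
    (hcat : OmegaCategorical L M) [Finite α] {φ : L.Formula α} {a : α → M} (ha : φ.Realize a) :
    ∃ b : α → M, φ.Realize b ∧ IsIsolated L b := by
  by_contra! hno
  let P := {ψ : L.Formula α // (∃ b : α → M, ψ.Realize b) ∧ ∀ b : α → M, ψ.Realize b → φ.Realize b}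
  have step (ψ : P) (t : α → M) : ∃ χ : P, ¬ χ.1.Realize t ∧
      ∀ b : α → M, χ.1.Realize b → ψ.1.Realize b := by
    obtain ⟨ψ, ⟨b, hb⟩, hψ⟩ := ψ
    by_cases hbt : EqType L b t
    · have := hno b (hψ b hb)
      simp only [IsIsolated, EqType, not_exists, not_and, not_forall] at this
      obtain ⟨c, hc, θ, hθ⟩ := this ψ hb
      by_cases hθb : θ.Realize b
      · refine ⟨⟨ψ ⊓ θ.not, ⟨c, ?_⟩, fun d hd => hψ d ?_⟩, ?_, fun d hd => ?_⟩
        · simp only [Formula.realize_inf, Formula.realize_not]; tauto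
        · exact (Formula.realize_inf.1 hd).1
        · simp only [Formula.realize_inf, Formula.realize_not, ← hbt θ]; tauto
        · exact (Formula.realize_inf.1 hd).1
      · refine ⟨⟨ψ ⊓ θ, ⟨c, ?_⟩, fun d hd => hψ d ?_⟩, ?_, fun d hd => ?_⟩
        · simp only [Formula.realize_inf]; tauto
        · exact (Formula.realize_inf.1 hd).1
        · simp only [Formula.realize_inf, ← hbt θ]; tauto
        · exact (Formula.realize_inf.1 hd).1
    · simp only [EqType, not_forall] at hbt
      obtain ⟨θ, hθ⟩ := hbt
      by_cases hθb : θ.Realize b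
      · refine ⟨⟨ψ ⊓ θ, ⟨b, Formula.realize_inf.2 ⟨hb, hθb⟩⟩, fun d hd => hψ d ?_⟩, ?_,
          fun d hd => ?_⟩
        · exact (Formula.realize_inf.1 hd).1
        · simp only [Formula.realize_inf]; tauto
        · exact (Formula.realize_inf.1 hd).1
      · refine ⟨⟨ψ ⊓ θ.not, ⟨b, Formula.realize_inf.2 ⟨hb, hθb⟩⟩, fun d hd => hψ d ?_⟩, ?_,
          fun d hd => ?_⟩
        · exact (Formula.realize_inf.1 hd).1
        · simp only [Formula.realize_inf, Formula.realize_not]; tauto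
        · exact (Formula.realize_inf.1 hd).1
  choose next hnext hle using step
  obtain ⟨t, ht⟩ := exists_surjective_nat (α → M)
  let seq : ℕ → P := fun n => Nat.rec ⟨φ, ⟨a, ha⟩, fun _ => id⟩ (fun n ψ => next ψ (t n)) n
  have hmono : ∀ i j, i ≤ j → ∀ b : α → M, (seq j).1.Realize b → (seq i).1.Realize b := by
    intro i j hij
    induction hij with
    | refl => exact fun _ => id
    | step _ ih => exact fun b hb => ih b (hle _ _ b hb)
  obtain ⟨v, hv⟩ := hcat.exists_realize_of_finset (fun n => (seq n).1) fun s => by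
    obtain ⟨b, hb⟩ := (seq (s.sup id)).2.1
    exact ⟨b, fun i hi => hmono i _ (Finset.le_sup (f := id) hi) b hb⟩
  obtain ⟨n, rfl⟩ := ht v
  exact hnext (seq n) (t n) (hv (n + 1))

theorem OmegaCategorical.exists_isIsolated_extension [Countable L.Symbols] [Countable M]
    [Infinite M] (hcat : OmegaCategorical L M) [Finite α] [Finite β] {φ : L.Formula β} {c : β → M}
    (hφ : φ.Realize c) {σ : α → β} (hc : IsIsolated L (c ∘ σ)) :
    ∃ d : β → M, φ.Realize d ∧ IsIsolated L d ∧ d ∘ σ = c ∘ σ := by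
  obtain ⟨θ, hθ, hθ'⟩ := hc
  obtain ⟨b, hb, hbi⟩ := hcat.exists_isIsolated (φ := φ ⊓ θ.relabel σ) (a := c)
    (Formula.realize_inf.2 ⟨hφ, Formula.realize_relabel.2 hθ⟩)
  rw [Formula.realize_inf, Formula.realize_relabel] at hb
  obtain ⟨d, hd, hdc⟩ := hbi.exists_eqType_comp_eq (hθ' _ hb.2).symm
  exact ⟨d, (hd φ).1 hb.1, hbi.congr hd, hdc⟩

/-- An `ω`-categorical countable structure has an elementary substructure whose finite tuples all
have isolated type in the ambient structure. -/
theorem OmegaCategorical.exists_atomic_elementarySubstructure [L.IsRelational]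
    [Countable L.Symbols] [Countable M] [Infinite M] (hcat : OmegaCategorical L M) :
    ∃ S : L.ElementarySubstructure M,
      ∀ (α : Type) [Finite α] (a : α → M), (∀ i, a i ∈ S) → IsIsolated L a := by
  classical
  let P := {F : Finset M // IsIsolated L (Subtype.val : F → M)}
  let ι := Σ n : ℕ, L.BoundedFormula Empty (n + 1) × (Fin n → M)
  have hform (n : ℕ) : Countable (L.BoundedFormula Empty n) :=
    (sigma_mk_injective (β := fun n => L.BoundedFormula Empty n) (i := n)).countable
  have : Encodable ι := Encodable.ofCountable _
  let W (t : ι) (F : P) : Prop := (∀ i, t.2.2 i ∈ F.1) ∧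
    ((∃ d : M, t.2.1.Realize default (Fin.snoc t.2.2 d : _ → M)) →
      ∃ d ∈ F.1, t.2.1.Realize default (Fin.snoc t.2.2 d : _ → M))
  let D (t : ι) : Order.Cofinal P :=
    { carrier := {F | W t F ∨ ∀ G : P, F ≤ G → ¬ ∀ i, t.2.2 i ∈ G.1}
      isCofinal := by
        intro F
        by_cases hF : ∀ G : P, F ≤ G → ¬ ∀ i, t.2.2 i ∈ G.1
        · exact ⟨F, Or.inr hF, le_rfl⟩
        push Not at hF
        obtain ⟨G, hFG, hG⟩ := hF
        by_cases hd : ∃ d : M, t.2.1.Realize default (Fin.snoc t.2.2 d : _ → M)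
        swap
        · exact ⟨G, Or.inl ⟨hG, fun h => absurd h hd⟩, hFG⟩
        obtain ⟨d, hd⟩ := hd
        let τ : Empty ⊕ Fin (t.1 + 1) → G.1 ⊕ Unit :=
          Sum.elim Empty.elim (Fin.snoc (fun i => Sum.inl ⟨t.2.2 i, hG i⟩) (Sum.inr ()))
        have hτ (c : G.1 ⊕ Unit → M) (hc : c ∘ Sum.inl = Subtype.val) :
            (t.2.1.toFormula.relabel τ).Realize c ↔
              t.2.1.Realize default (Fin.snoc t.2.2 (c (Sum.inr ())) : _ → M) := by
          rw [Formula.realize_relabel, BoundedFormula.realize_toFormula]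
          have h1 : (c ∘ τ) ∘ Sum.inl = default := Subsingleton.elim _ _
          have h2 : (c ∘ τ) ∘ Sum.inr = (Fin.snoc t.2.2 (c (Sum.inr ())) : _ → M) := by
            funext i
            refine Fin.lastCases ?_ (fun j => ?_) i
            · simp [τ]
            · simpa [τ] using congrFun hc ⟨t.2.2 j, hG j⟩
          rw [h1, h2]
        obtain ⟨c, hc, hci, hcG⟩ := hcat.exists_isIsolated_extension
          (φ := t.2.1.toFormula.relabel τ) (c := Sum.elim (Subtype.val : G.1 → M) fun _ => d)
          (σ := Sum.inl) ((hτ _ rfl).2 hd) G.2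
        rw [hτ c hcG] at hc
        refine ⟨⟨insert (c (Sum.inr ())) G.1, hci.of_range_subset ?_⟩, Or.inl ⟨fun i => ?_,
          fun _ => ⟨_, ?_, hc⟩⟩, hFG.trans (Finset.subset_insert _ _)⟩
        · rintro ⟨x, hx⟩
          rcases Finset.mem_insert.1 hx with rfl | hx
          · exact ⟨Sum.inr (), rfl⟩
          · exact ⟨Sum.inl ⟨x, hx⟩, congrFun hcG ⟨x, hx⟩⟩
        · exact Finset.mem_insert_of_mem (hG i)
        · exact Finset.mem_insert_self _ _ }
  let F0 : P := ⟨∅, ⊤, Formula.realize_top.2 trivial, fun b _ φ => by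
    rw [Subsingleton.elim b Subtype.val]⟩
  let I := Order.idealOfCofinals F0 D
  have hI (s : Set M) (hs : s.Finite) (h : ∀ x ∈ s, ∃ F ∈ I, x ∈ F.1) (F : P) (hF : F ∈ I) :
      ∃ G ∈ I, F ≤ G ∧ ∀ x ∈ s, x ∈ G.1 := by
    induction s, hs using Set.Finite.induction_on with
    | empty => exact ⟨F, hF, le_rfl, by simp⟩
    | @insert x s _ _ ih =>
      obtain ⟨G, hG, hFG, hGs⟩ := ih fun y hy => h y (Set.mem_insert_of_mem _ hy)
      obtain ⟨H, hH, hxH⟩ := h x (Set.mem_insert _ _)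
      obtain ⟨K, hK, hGK, hHK⟩ := I.directed G hG H hH
      refine ⟨K, hK, hFG.trans hGK, fun y hy => ?_⟩
      rcases hy with rfl | hy
      · exact hHK hxH
      · exact hGK (hGs y hy)
  let S : L.Substructure M :=
    { carrier := {x | ∃ F ∈ I, x ∈ F.1}
      fun_mem := fun f => isEmptyElim f }
  refine ⟨⟨S, S.isElementary_of_exists fun n φ x a ha => ?_⟩, fun α _ a ha => ?_⟩
  · obtain ⟨F, hF, hFI⟩ := Order.cofinal_meets_idealOfCofinals F0 D ⟨n, φ, Subtype.val ∘ x⟩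
    rcases hF with hF | hF
    · obtain ⟨d, hd, hφ⟩ := hF.2 ⟨a, ha⟩
      exact ⟨⟨d, F, hFI, hd⟩, hφ⟩
    · obtain ⟨G, -, hFG, hG⟩ := hI (Set.range (Subtype.val ∘ x)) (Set.finite_range _)
        (by rintro _ ⟨i, rfl⟩; exact (x i).2) F hFI
      exact absurd (fun i => hG _ ⟨i, rfl⟩) (hF G hFG)
  · obtain ⟨G, -, -, hG⟩ := hI (Set.range a) (Set.finite_range _)
      (by rintro _ ⟨i, rfl⟩; exact ha i) F0 (Order.mem_idealOfCofinals _ _)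
    exact G.2.of_range_subset fun i => ⟨⟨a i, hG _ ⟨i, rfl⟩⟩, rfl⟩

/-- Every finite tuple of a countable `ω`-categorical structure has isolated type. -/
theorem OmegaCategorical.isIsolated [L.IsRelational] [Countable L.Symbols] [Countable M]
    [Infinite M] (hcat : OmegaCategorical L M) [Finite α] (a : α → M) : IsIsolated L a := by
  obtain ⟨S, hS⟩ := hcat.exists_atomic_elementarySubstructure
  obtain ⟨e⟩ := exists_equiv_of_elementarilyEquivalent hcat S
  have he (φ : L.Formula α) (b : α → M) : φ.Realize (fun i => (e (b i) : M)) ↔ φ.Realize b :=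
    (S.subtype.map_formula φ (fun i => e (b i))).trans (StrongHomClass.realize_formula e φ)
  obtain ⟨φ, hφ, hφ'⟩ := hS α (fun i => (e (a i) : M)) fun i => (e (a i)).2
  exact ⟨φ, (he φ a).1 hφ, fun b hb ψ =>
    (he ψ a).symm.trans ((hφ' _ ((he φ b).2 hb) ψ).trans (he ψ b))⟩

/-- A countable `ω`-categorical structure has finitely many types of tuples of given finite
length. -/
theorem OmegaCategorical.exists_finset_isolating [L.IsRelational] [Countable L.Symbols]
    [Countable M] [Infinite M] (hcat : OmegaCategorical L M) (α : Type) [Finite α] :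
    ∃ Φ : Finset (L.Formula α), ∀ a : α → M, ∃ φ ∈ Φ, φ.Realize a ∧
      ∀ b : α → M, φ.Realize b → EqType L a b := by
  classical
  by_contra! hno
  let ι := {φ : L.Formula α // ∀ a b : α → M, φ.Realize a → φ.Realize b → EqType L a b}
  obtain ⟨a, ha⟩ := hcat.exists_realize_of_finset (fun φ : ι => φ.1.not) fun s => by
    obtain ⟨a, ha⟩ := hno (s.image Subtype.val)
    refine ⟨a, fun φ hφ hr => ?_⟩
    obtain ⟨b, hb, hab⟩ := ha φ.1 (Finset.mem_image_of_mem _ hφ) hr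
    exact hab (φ.2 a b hr hb)
  obtain ⟨φ, hφ, hφ'⟩ := hcat.isIsolated a
  exact ha ⟨φ, fun b c hb hc => (hφ' b hb).symm.trans (hφ' c hc)⟩ hφ

end Categorical

section QuantifierFreeTypes

variable {L : FirstOrder.Language.{0, 0}} {M N P : Type} [L.Structure M] [L.Structure N]
  [L.Structure P] {α β : Type}

/-- Two tuples satisfy the same equalities and relations. -/
def EqQFType (L : FirstOrder.Language.{0, 0}) {M N : Type} [L.Structure M] [L.Structure N]
    {α : Type} (a : α → M) (b : α → N) : Prop :=
  (∀ i j, a i = a j ↔ b i = b j) ∧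
    ∀ (n : ℕ) (R : L.Relations n) (x : Fin n → α),
      Structure.RelMap R (a ∘ x) ↔ Structure.RelMap R (b ∘ x)

theorem EqQFType.symm {a : α → M} {b : α → N} (h : EqQFType L a b) : EqQFType L b a :=
  ⟨fun i j => (h.1 i j).symm, fun n R x => (h.2 n R x).symm⟩

theorem EqQFType.trans {a : α → M} {b : α → N} {c : α → P} (h : EqQFType L a b)
    (h' : EqQFType L b c) : EqQFType L a c :=
  ⟨fun i j => (h.1 i j).trans (h'.1 i j), fun n R x => (h.2 n R x).trans (h'.2 n R x)⟩

theorem EqQFType.comp {a : α → M} {b : α → N} (h : EqQFType L a b) (σ : β → α) :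
    EqQFType L (a ∘ σ) (b ∘ σ) :=
  ⟨fun i j => h.1 (σ i) (σ j), fun n R x => h.2 n R (σ ∘ x)⟩

theorem eqQFType_embedding (f : M ↪[L] N) (a : α → M) : EqQFType L a (f ∘ a) :=
  ⟨fun _ _ => f.injective.eq_iff.symm, fun _ R x => (f.map_rel R (a ∘ x)).symm⟩

theorem EqType.eqQFType {a b : α → M} (h : EqType L a b) : EqQFType L a b := by
  refine ⟨fun i j => ?_, fun n R x => ?_⟩
  · simpa using h ((Term.var i).equal (Term.var j))
  · simpa [Formula.realize_rel, Function.comp_def] using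
      h (R.formula fun k => Term.var (x k))

/-- A map with the same quantifier-free type as an embedding is an embedding. -/
def EqQFType.toEmbedding [L.IsRelational] {i : N ↪[L] P} {c : N → M} (h : EqQFType L i c) :
    N ↪[L] M where
  toFun := c
  inj' x y hxy := i.injective ((h.1 x y).2 hxy)
  map_fun' f := isEmptyElim f
  map_rel' R x := (h.2 _ R x).symm.trans (i.map_rel R x)

end QuantifierFreeTypes

section Amalgams

variable {L : FirstOrder.Language.{0, 0}} [L.IsRelational] {M A B C : Type} [L.Structure M]
  [L.Structure A] [L.Structure B] [L.Structure C]

/-- The substructure on a subset of a structure for a relational language. -/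
def ofSet (L : FirstOrder.Language.{0, 0}) [L.IsRelational] {M : Type} [L.Structure M]
    (s : Set M) : L.Substructure M where
  carrier := s
  fun_mem f := isEmptyElim f

theorem ofSet_mem_finAge {s : Set M} (hs : s.Finite) :
    (⟨ofSet L s, inferInstance⟩ : Bundled L.Structure) ∈ FinAge L M :=
  ⟨hs, ⟨(ofSet L s).subtype⟩⟩

theorem hasAmalgam_finAge_iff [Finite B] [Finite C] (f : A ↪[L] B) (g : A ↪[L] C) :
    HasAmalgam L (FinAge L M) f g ↔
      ∃ (u : B ↪[L] M) (v : C ↪[L] M), ∀ x, u (f x) = v (g x) := by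
  constructor
  · rintro ⟨D, ⟨-, ⟨h⟩⟩, f0, g0, hfg⟩
    exact ⟨h.comp f0, h.comp g0, fun x => congrArg h (hfg x)⟩
  · rintro ⟨u, v, huv⟩
    refine ⟨_, ofSet_mem_finAge ((Set.finite_range u).union (Set.finite_range v)),
      u.codRestrict _ fun x => Or.inl ⟨x, rfl⟩, v.codRestrict _ fun x => Or.inr ⟨x, rfl⟩,
      fun x => Subtype.ext (huv x)⟩

end Amalgams

section Witnesses

theorem ModelComplete.realize_comp_iff {L : FirstOrder.Language.{0, 0}} {M : Type} [L.Structure M]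
    [Nonempty M] {α : Type} [Finite α] (hmc : ModelComplete L M) (f : M ↪[L] M)
    (φ : L.Formula α) (a : α → M) : φ.Realize (f ∘ a) ↔ φ.Realize a := by
  obtain ⟨p, ⟨e⟩⟩ := Finite.exists_equiv_fin α
  have h : (φ.relabel e).Realize (f ∘ a ∘ e.symm) ↔ (φ.relabel e).Realize (a ∘ e.symm) :=
    hmc (Theory.ModelType.of _ M) (Theory.ModelType.of _ M) f p (φ.relabel e) (a ∘ e.symm)
  simpa only [Formula.realize_relabel, Function.comp_assoc, Equiv.symm_comp_self,
    Function.comp_id] using h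

/-- The finite set `F` witnesses the truth of `φ` at `a`: every map on `a` and `F` which
respects quantifier-free types preserves `φ`. -/
def IsWitness {L : FirstOrder.Language.{0, 0}} {M : Type} [L.Structure M] {α : Type}
    (φ : L.Formula α) (a : α → M) (F : Finset M) : Prop :=
  ∀ (b : α → M) (d : F → M),
    EqQFType L (Sum.elim a (Subtype.val : F → M)) (Sum.elim b d) → φ.Realize b

theorem IsWitness.realize_comp {L : FirstOrder.Language.{0, 0}} {M B : Type} [L.Structure M]
    [L.Structure B] {α : Type} {φ : L.Formula α} {i : B ↪[L] M} {a : α → B} {F : Finset M}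
    (hF : IsWitness φ (i ∘ a) F) (hFi : ∀ x ∈ F, ∃ y, i y = x) (u : B ↪[L] M) :
    φ.Realize (u ∘ a) := by
  choose r hr using fun x : F => hFi x x.2
  have h := (eqQFType_embedding i (Sum.elim a r)).symm.trans (eqQFType_embedding u (Sum.elim a r))
  rw [Sum.comp_elim, Sum.comp_elim, show i ∘ r = Subtype.val from funext hr] at h
  exact hF _ _ h

variable {L : FirstOrder.Language.{0, 0}} [L.IsRelational] [Countable L.Symbols] {M : Type}
  [L.Structure M] [Countable M] [Infinite M] {α : Type} [Finite α]

theorem ModelComplete.exists_isWitness (hmc : ModelComplete L M) (hcat : OmegaCategorical L M)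
    {φ : L.Formula α} {a : α → M} (ha : φ.Realize a) : ∃ F : Finset M, IsWitness φ a F := by
  classical
  have := Fintype.ofFinite α
  by_contra! hno
  simp only [IsWitness, not_forall] at hno
  let ι := {p : M × M // p.1 ≠ p.2} ⊕ (Σ n : ℕ, L.Relations n × (Fin n → M)) ⊕ Unit
  let lit (r : Σ n : ℕ, L.Relations n × (Fin n → M)) : L.Formula M :=
    r.2.1.formula fun i => Term.var (r.2.2 i)
  have hlit (r) (v : M → M) : (lit r).Realize v ↔ Structure.RelMap r.2.1 (v ∘ r.2.2) := by
    simp [lit, Formula.realize_rel, Function.comp_def]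
  let Θ : ι → L.Formula M := Sum.elim
    (fun p => ((Term.var p.1.1).equal (Term.var p.1.2)).not)
    (Sum.elim (fun r => if (lit r).Realize id then lit r else (lit r).not)
      fun _ => (φ.relabel a).not)
  have hΘ (r) (v : M → M) : (Θ (Sum.inr (Sum.inl r))).Realize v ↔
      (Structure.RelMap r.2.1 (v ∘ r.2.2) ↔ Structure.RelMap r.2.1 r.2.2) := by
    by_cases h : Structure.RelMap r.2.1 r.2.2 <;> simp [Θ, hlit, h]
  let supp : ι → Finset M := Sum.elim (fun p => {p.1.1, p.1.2})
    (Sum.elim (fun r => Finset.univ.image r.2.2) fun _ => ∅)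
  obtain ⟨v, hv⟩ := hcat.exists_realize_of_finset Θ fun s => by
    let F := s.biUnion supp ∪ Finset.univ.image a
    obtain ⟨b, d, hbd, hb⟩ := hno F
    let v : M → M := fun x => if h : x ∈ F then d ⟨x, h⟩ else x
    have hvF (x : F) : v x = d x := dif_pos x.2
    have hva : v ∘ a = b := by
      funext i
      have hi : a i ∈ F := Finset.mem_union_right _ (Finset.mem_image_of_mem _ (Finset.mem_univ i))
      exact (hvF ⟨a i, hi⟩).trans ((hbd.1 (Sum.inr ⟨a i, hi⟩) (Sum.inl i)).1 rfl)
    refine ⟨v, ?_⟩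
    rintro (⟨⟨x, y⟩, hxy⟩ | r | u) hi
    · have hs : ∀ z ∈ ({x, y} : Finset M), z ∈ F := fun z hz =>
        Finset.mem_union_left _ (Finset.mem_biUnion.2 ⟨_, hi, hz⟩)
      have hx := hs x (by simp)
      have hy := hs y (by simp)
      have h1 := hbd.1 (Sum.inr ⟨x, hx⟩) (Sum.inr ⟨y, hy⟩)
      have h2 : v x ≠ v y := by
        rw [hvF ⟨x, hx⟩, hvF ⟨y, hy⟩]
        exact fun h => hxy (h1.2 h)
      simpa [Θ] using h2
    · have hs (j) : r.2.2 j ∈ F := Finset.mem_union_left _ (Finset.mem_biUnion.2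
        ⟨_, hi, Finset.mem_image_of_mem _ (Finset.mem_univ j)⟩)
      rw [hΘ]
      have h1 := hbd.2 r.1 r.2.1 fun j => Sum.inr ⟨r.2.2 j, hs j⟩
      have h2 : v ∘ r.2.2 = Sum.elim b d ∘ fun j => Sum.inr ⟨r.2.2 j, hs j⟩ :=
        funext fun j => hvF ⟨r.2.2 j, hs j⟩
      rw [h2]
      exact h1.symm
    · have h2 : (φ.relabel a).not.Realize v := by
        rw [Formula.realize_not, Formula.realize_relabel, hva]
        exact hb
      exact h2
  have hinj : EqQFType L (Embedding.refl L M) v := by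
    refine ⟨fun x y => ⟨fun h => congrArg v h, fun h => ?_⟩, fun n R x => ?_⟩
    · by_contra hxy
      have := hv (Sum.inl ⟨(x, y), hxy⟩)
      exact absurd h (by simpa [Θ] using this)
    · exact ((hΘ ⟨n, R, x⟩ v).1 (hv (Sum.inr (Sum.inl ⟨n, R, x⟩)))).symm
  have h1 : ¬ φ.Realize (v ∘ a) := by
    have h2 : (φ.relabel a).not.Realize v := hv (Sum.inr (Sum.inr ()))
    rwa [Formula.realize_not, Formula.realize_relabel] at h2
  exact h1 ((hmc.realize_comp_iff hinj.toEmbedding φ a).2 ha)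

/-- Witnesses for the truth of a fixed formula have bounded size. -/
theorem ModelComplete.exists_card_isWitness_le (hmc : ModelComplete L M)
    (hcat : OmegaCategorical L M) (φ : L.Formula α) :
    ∃ q : ℕ, ∀ a : α → M, φ.Realize a → ∃ F : Finset M, F.card ≤ q ∧ IsWitness φ a F := by
  classical
  obtain ⟨Φ, hΦ⟩ := hcat.exists_finset_isolating α
  have hχ (χ : L.Formula α) : ∃ q : ℕ, ∀ a : α → M, φ.Realize a → χ.Realize a →
      (∀ b : α → M, χ.Realize b → EqType L a b) → ∃ F : Finset M, F.card ≤ q ∧ IsWitness φ a F := by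
    by_cases h : ∃ a : α → M, φ.Realize a ∧ χ.Realize a
    swap
    · exact ⟨0, fun a h1 h2 => absurd ⟨a, h1, h2⟩ h⟩
    obtain ⟨a, ha, hχa⟩ := h
    obtain ⟨F, hF⟩ := hmc.exists_isWitness hcat ha
    refine ⟨F.card, fun a' _ _ ha' => ?_⟩
    obtain ⟨c, hc, hca⟩ := (hcat.isIsolated (Sum.elim a (Subtype.val : F → M))).exists_eqType_comp_eq
      (σ := Sum.inl) (b := a') (ha' a hχa).symm
    refine ⟨Finset.univ.image (c ∘ Sum.inr), Finset.card_image_le.trans (by simp), fun b d hbd => ?_⟩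
    let τ : α ⊕ F → α ⊕ (Finset.univ.image (c ∘ Sum.inr) : Finset M) := Sum.map id fun x =>
      ⟨c (Sum.inr x), Finset.mem_image_of_mem (c ∘ Sum.inr) (Finset.mem_univ x)⟩
    have h1 : Sum.elim a' Subtype.val ∘ τ = c := by
      funext x
      rcases x with i | x
      · exact (congrFun hca i).symm
      · rfl
    have h2 := hbd.comp τ
    rw [h1] at h2
    have h3 : Sum.elim b d ∘ τ = Sum.elim b fun x => d ⟨c (Sum.inr x),
        Finset.mem_image_of_mem (c ∘ Sum.inr) (Finset.mem_univ x)⟩ := by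
      funext x
      rcases x with i | x <;> rfl
    rw [h3] at h2
    exact hF b _ (hc.eqQFType.trans h2)
  choose q hq using hχ
  refine ⟨Φ.sup q, fun a ha => ?_⟩
  obtain ⟨χ, hχΦ, hχa, hiso⟩ := hΦ a
  obtain ⟨F, hF, hF'⟩ := hq χ a ha hχa hiso
  exact ⟨F, hF.trans (Finset.le_sup hχΦ), hF'⟩

end Witnesses

section Homogenizing

variable {L : FirstOrder.Language.{0, 0}} {M : Type} [L.Structure M] {n : ℕ} {k : Fin n → ℕ}

instance expLang.isRelational (n : ℕ) (k : Fin n → ℕ) : (expLang n k).IsRelational :=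
  fun _ => inferInstanceAs (IsEmpty Empty)

theorem eqQFType_expansion_iff (φ : ∀ i, L.Formula (Fin (k i))) {α : Type} {a b : α → M} :
    letI : (expLang n k).Structure M := expStructure L M φ
    EqQFType (L.sum (expLang n k)) a b ↔ EqQFType L a b ∧
      ∀ i (t : Fin (k i) → α), (φ i).Realize (a ∘ t) ↔ (φ i).Realize (b ∘ t) := by
  refine ⟨fun h => ⟨⟨h.1, fun m R => h.2 m (Sum.inl R)⟩, fun i => h.2 (k i) (Sum.inr ⟨i, rfl⟩)⟩,
    fun h => ⟨h.1.1, fun m R x => ?_⟩⟩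
  rcases R with R | ⟨i, rfl⟩
  · exact h.1.2 m R x
  · exact h.2 i x

theorem Homogenizes.exists_embedding [L.IsRelational] {φ : ∀ i, L.Formula (Fin (k i))}
    (h : Homogenizes L M φ) {A : Type} [L.Structure A] [Finite A] (a b : A ↪[L] M)
    (hab : ∀ i (t : Fin (k i) → A), (φ i).Realize (a ∘ t) ↔ (φ i).Realize (b ∘ t)) :
    ∃ σ : M ↪[L] M, ∀ x, σ (a x) = b x := by
  let : (expLang n k).Structure M := expStructure L M φ
  let S := ofSet (L.sum (expLang n k)) (Set.range a)
  have : Finite S := Set.finite_range a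
  choose r hr using fun x : S => (x.2 : x.1 ∈ Set.range a)
  have hqf : EqQFType (L.sum (expLang n k)) a b := (eqQFType_expansion_iff φ).2
    ⟨(eqQFType_embedding a id).symm.trans (eqQFType_embedding b id), hab⟩
  have hS : EqQFType (L.sum (expLang n k)) S.subtype (b ∘ r) := by
    rw [show (S.subtype : S → M) = a ∘ r from funext fun x => (hr x).symm]
    exact hqf.comp r
  obtain ⟨g, hg⟩ := h S Substructure.FG.of_finite hS.toEmbedding
  refine ⟨⟨⟨g, g.injective⟩, fun f => isEmptyElim f, fun R x => g.map_rel (Sum.inl R) x⟩,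
    fun x => ?_⟩
  have h1 : b (r ⟨a x, x, rfl⟩) = g (a x) := DFunLike.congr_fun hg ⟨a x, x, rfl⟩
  exact h1.symm.trans (congrArg b (a.injective (hr ⟨a x, x, rfl⟩)))

/-- If the formulas `φ` together with the quantifier-free formulas determine all types, then
they are homogenizing. -/
theorem OmegaCategorical.homogenizes [L.IsRelational] [Countable L.Symbols] [Countable M]
    [Infinite M] (hcat : OmegaCategorical L M) (φ : ∀ i, L.Formula (Fin (k i)))
    (h : ∀ (α : Type) [Finite α] (a b : α → M), EqQFType L a b →
      (∀ i (t : Fin (k i) → α), (φ i).Realize (a ∘ t) ↔ (φ i).Realize (b ∘ t)) → EqType L a b) :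
    Homogenizes L M φ := by
  let : (expLang n k).Structure M := expStructure L M φ
  refine (isUltrahomogeneous_iff_IsExtensionPair Structure.cg_of_countable).2
    (isExtensionPair_iff_exists_embedding_closure_singleton_sup.2 fun S hS f m => ?_)
  have := hS.finite
  have := ((Substructure.fg_closure_singleton (L := L.sum (expLang n k)) m).sup hS).finite
  let S' := Substructure.closure (L.sum (expLang n k)) {m} ⊔ S
  have hf := (eqQFType_expansion_iff φ).1
    ((eqQFType_embedding S.subtype id).symm.trans (eqQFType_embedding f id))
  obtain ⟨c, hc, hcf⟩ := (hcat.isIsolated (Subtype.val : S' → M)).exists_eqType_comp_eq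
    (σ := Substructure.inclusion (le_sup_right : S ≤ S')) (b := f) (h S _ _ hf.1 hf.2)
  have hc' : EqQFType (L.sum (expLang n k)) S'.subtype c :=
    (eqQFType_expansion_iff φ).2 ⟨hc.eqQFType, fun i t => hc.comp t (φ i)⟩
  exact ⟨hc'.toEmbedding, Embedding.ext fun x => (congrFun hcf x).symm⟩

end Homogenizing

section SEAP

variable {L : FirstOrder.Language.{0, 0}} [L.IsRelational] {M : Type} [L.Structure M]

theorem card_ofSet_sub_le {B : Type} [Finite B] (i : B → M) (hi : i.Injective)
    (F : Finset M) : Nat.card (ofSet L (Set.range i ∪ F)) - Nat.card B ≤ F.card := by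
  have h1 := Set.ncard_union_le (Set.range i) (F : Set M)
  rw [Set.ncard_coe_finset, Set.ncard_range_of_injective hi] at h1
  exact Nat.sub_le_iff_le_add'.2 h1

/-- If two incompatible formulas have small witnesses at the images of a tuple of `A` in `B` and
in `C`, then small parts of small extensions of `B` and `C` fail to amalgamate. -/
theorem exists_not_hasAmalgam_of_isWitness {p : ℕ} {ψ ψ' : L.Formula (Fin p)}
    (hψ : ∀ v : Fin p → M, ψ.Realize v → ¬ ψ'.Realize v) {A B C : Type} [L.Structure A]
    [L.Structure B] [L.Structure C] [Finite B] [Finite C] (f : A ↪[L] B) (g : A ↪[L] C)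
    (i : B ↪[L] M) (j : C ↪[L] M) (t : Fin p → A) {F F' : Finset M}
    (hF : IsWitness ψ (i ∘ f ∘ t) F) (hF' : IsWitness ψ' (j ∘ g ∘ t) F') :
    ∃ A0 : L.Substructure A, Nat.card A0 ≤ p ∧
      ∃ B0 ∈ FinAge L M, ∃ C0 ∈ FinAge L M, ∃ (eB : B ↪[L] B0) (eC : C ↪[L] C0),
        Nat.card B0 - Nat.card B ≤ F.card ∧ Nat.card C0 - Nat.card C ≤ F'.card ∧
        ¬ HasAmalgam L (FinAge L M) ((eB.comp f).comp A0.subtype) ((eC.comp g).comp A0.subtype) := by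
  have hB := (Set.finite_range i).union F.finite_toSet
  have hC := (Set.finite_range j).union F'.finite_toSet
  have : Finite (ofSet L (Set.range i ∪ F)) := hB
  have : Finite (ofSet L (Set.range j ∪ F')) := hC
  refine ⟨ofSet L (Set.range t), (Finite.card_range_le t).trans_eq (Nat.card_fin p), _,
    ofSet_mem_finAge hB, _, ofSet_mem_finAge hC, i.codRestrict _ fun x => Or.inl ⟨x, rfl⟩,
    j.codRestrict _ fun x => Or.inl ⟨x, rfl⟩, card_ofSet_sub_le i i.injective F,
    card_ofSet_sub_le j j.injective F', fun h => ?_⟩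
  obtain ⟨u, v, huv⟩ := (hasAmalgam_finAge_iff _ _).1 h
  have h1 := IsWitness.realize_comp (i := (ofSet L (Set.range i ∪ F)).subtype)
    (a := fun x => ⟨i (f (t x)), Or.inl ⟨_, rfl⟩⟩) hF (fun x hx => ⟨⟨x, Or.inr hx⟩, rfl⟩) u
  have h2 := IsWitness.realize_comp (i := (ofSet L (Set.range j ∪ F')).subtype)
    (a := fun x => ⟨j (g (t x)), Or.inl ⟨_, rfl⟩⟩) hF' (fun x hx => ⟨⟨x, Or.inr hx⟩, rfl⟩) v
  refine hψ _ h1 ?_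
  convert h2 using 1
  exact funext fun x => huv ⟨t x, x, rfl⟩

variable [Countable L.Symbols] [Countable M] [Infinite M]

theorem ModelComplete.seap_of_homogenizable (hmc : ModelComplete L M)
    (hcat : OmegaCategorical L M) (h : Homogenizable L M) : SEAP L (FinAge L M) := by
  obtain ⟨n, k, φ, h⟩ := h
  choose q hq using fun i => hmc.exists_card_isWitness_le hcat (φ i)
  choose q' hq' using fun i => hmc.exists_card_isWitness_le hcat (φ i).not
  refine ⟨Finset.univ.sup k + 1, Finset.univ.sup q + Finset.univ.sup q' + 1, ?_⟩
  rintro A B C ⟨_, -⟩ ⟨_, ⟨i⟩⟩ ⟨_, ⟨j⟩⟩ f g hfg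
  obtain ⟨l, t, hl⟩ : ∃ l, ∃ t : Fin (k l) → A,
      ¬ ((φ l).Realize (i ∘ f ∘ t) ↔ (φ l).Realize (j ∘ g ∘ t)) := by
    by_contra! hno
    obtain ⟨σ, hσ⟩ := h.exists_embedding (i.comp f) (j.comp g) hno
    exact hfg ((hasAmalgam_finAge_iff f g).2 ⟨σ.comp i, j, hσ⟩)
  have hk : k l ≤ Finset.univ.sup k := Finset.le_sup (Finset.mem_univ l)
  have hql : q l ≤ Finset.univ.sup q := Finset.le_sup (Finset.mem_univ l)
  have hql' : q' l ≤ Finset.univ.sup q' := Finset.le_sup (Finset.mem_univ l)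
  by_cases hi : (φ l).Realize (i ∘ f ∘ t)
  · obtain ⟨F, hFc, hF⟩ := hq l _ hi
    obtain ⟨F', hFc', hF'⟩ := hq' l (j ∘ g ∘ t) fun hj => hl (iff_of_true hi hj)
    obtain ⟨A0, hA, B0, hB0, C0, hC0, eB, eC, hB, hC, hno⟩ :=
      exists_not_hasAmalgam_of_isWitness (fun _ h1 h2 => Formula.realize_not.1 h2 h1)
        f g i j t hF hF'
    exact ⟨A0, by lia, B0, hB0, C0, hC0, eB, eC, by lia, by lia, hno⟩
  · obtain ⟨F, hFc, hF⟩ := hq' l _ hi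
    obtain ⟨F', hFc', hF'⟩ := hq l (j ∘ g ∘ t) (by tauto)
    obtain ⟨A0, hA, B0, hB0, C0, hC0, eB, eC, hB, hC, hno⟩ :=
      exists_not_hasAmalgam_of_isWitness (fun _ h1 h2 => Formula.realize_not.1 h1 h2)
        f g i j t hF hF'
    exact ⟨A0, by lia, B0, hB0, C0, hC0, eB, eC, by lia, by lia, hno⟩

/-- Under `SEAP` the type of a tuple is determined by its quantifier-free type and the types of
its short subtuples. -/
theorem ModelComplete.eqType_of_seapAt (hmc : ModelComplete L M) (hcat : OmegaCategorical L M)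
    {k m : ℕ} (h : SEAPAt L (FinAge L M) k m) {α : Type} [Finite α] {a b : α → M}
    (hab : EqQFType L a b) (hk : ∀ j < k, ∀ t : Fin j → α, EqType L (a ∘ t) (b ∘ t)) :
    EqType L a b := by
  obtain ⟨φ, hφ, hφa⟩ := hcat.isIsolated a
  obtain ⟨ψ, hψ, hψb⟩ := hcat.isIsolated b
  obtain ⟨F, hF⟩ := hmc.exists_isWitness hcat hφ
  obtain ⟨F', hF'⟩ := hmc.exists_isWitness hcat hψ
  let A := ofSet L (Set.range a)
  let B := ofSet L (Set.range a ∪ F)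
  let C := ofSet L (Set.range b ∪ F')
  have hB := (Set.finite_range a).union F.finite_toSet
  have hC := (Set.finite_range b).union F'.finite_toSet
  have : Finite A := Set.finite_range a
  have : Finite B := hB
  have : Finite C := hC
  let a' : α → A := fun i => ⟨a i, i, rfl⟩
  choose r hr using fun x : A => (x.2 : x.1 ∈ Set.range a)
  have har (x : A) : a' (r x) = x := Subtype.ext (hr x)
  let f : A ↪[L] B := Substructure.inclusion fun _ hx => Or.inl hx
  let b' : α → C := fun i => ⟨b i, Or.inl ⟨i, rfl⟩⟩
  have hg : EqQFType L A.subtype (b' ∘ r) := by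
    rw [show (A.subtype : A → M) = a ∘ r from funext fun x => (hr x).symm]
    exact (hab.comp r).trans (eqQFType_embedding C.subtype (b' ∘ r)).symm
  let g : A ↪[L] C := hg.toEmbedding
  have hga : g ∘ a' = b' :=
    funext fun i => Subtype.ext ((hab.1 (r (a' i)) i).1 (hr (a' i)))
  have hu (u : B ↪[L] M) : EqType L a (u ∘ f ∘ a') :=
    hφa _ (IsWitness.realize_comp (i := B.subtype) hF (fun x hx => ⟨⟨x, Or.inr hx⟩, rfl⟩) u)
  have hv (v : C ↪[L] M) : EqType L b (v ∘ g ∘ a') := by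
    rw [hga]
    exact hψb _
      (IsWitness.realize_comp (i := C.subtype) hF' (fun x hx => ⟨⟨x, Or.inr hx⟩, rfl⟩) v)
  by_cases hfg : HasAmalgam L (FinAge L M) f g
  · obtain ⟨u, v, huv⟩ := (hasAmalgam_finAge_iff f g).1 hfg
    have huv' : u ∘ f ∘ a' = v ∘ g ∘ a' := funext fun i => huv (a' i)
    exact (hu u).trans (huv' ▸ (hv v).symm)
  · obtain ⟨A0, hA0, B0, ⟨_, ⟨u⟩⟩, C0, ⟨_, ⟨v⟩⟩, eB, eC, -, -, hno⟩ :=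
      h ⟨A, inferInstance⟩ ⟨B, inferInstance⟩ ⟨C, inferInstance⟩
        (ofSet_mem_finAge (Set.finite_range a)) (ofSet_mem_finAge hB) (ofSet_mem_finAge hC) f g hfg
    let e := Finite.equivFin A0
    let t : Fin (Nat.card A0) → α := fun x => r (e.symm x)
    have ht (x : Fin (Nat.card A0)) : a' (t x) = e.symm x := har _
    have hvu : EqType L (v ∘ fun x => eC (g (e.symm x))) fun x => u (eB (f (e.symm x))) := by
      have h1 := ((hv (v.comp eC)).comp t).symm.trans
        ((hk _ hA0 t).symm.trans ((hu (u.comp eB)).comp t))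
      simpa only [Function.comp_def, ht, Embedding.comp_apply] using h1
    obtain ⟨d, hd, hdu⟩ := (hcat.isIsolated v).exists_eqType_comp_eq hvu
    refine absurd ((hasAmalgam_finAge_iff _ _).2 ⟨u, hd.eqQFType.toEmbedding, fun x => ?_⟩) hno
    have h1 := congrFun hdu (e x)
    simp only [Function.comp_apply, Equiv.symm_apply_apply] at h1
    exact h1.symm

theorem ModelComplete.homogenizable_of_seap (hmc : ModelComplete L M)
    (hcat : OmegaCategorical L M) (h : SEAP L (FinAge L M)) : Homogenizable L M := by
  obtain ⟨k, m, h⟩ := h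
  choose Φ hΦ using fun j : ℕ => hcat.exists_finset_isolating (Fin j)
  let e := Finite.equivFin (Σ j : Fin k, Φ j)
  refine ⟨_, fun i => (e.symm i).1, fun i => (e.symm i).2.1,
    hcat.homogenizes _ fun α _ a b hab hφ => hmc.eqType_of_seapAt hcat h hab fun j hj t => ?_⟩
  obtain ⟨χ, hχ, ha, hb⟩ := hΦ j (a ∘ t)
  have h1 (s : Σ j : Fin k, Φ j) (t : Fin s.1 → α) :
      s.2.1.Realize (a ∘ t) ↔ s.2.1.Realize (b ∘ t) := by
    obtain ⟨i, rfl⟩ := e.symm.surjective s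
    exact hφ i t
  exact hb _ ((h1 ⟨⟨j, hj⟩, χ, hχ⟩ t).1 ha)

end SEAP

/-- For a countably infinite, model-complete, ω-categorical structure over a
finite relational vocabulary, `Age(M)` satisfies SEAP iff `M` is homogenizable. -/
theorem age_seap_iff_homogenizable
    (L : FirstOrder.Language.{0, 0}) [L.IsRelational] [Finite (Σ n : ℕ, L.Relations n)]
    (M : Type) [L.Structure M] [Countable M] [Infinite M]
    (hmc : ModelComplete L M) (hcat : OmegaCategorical L M) :
    SEAP L (FinAge L M) ↔ Homogenizable L M := by
  have : Countable L.Symbols :=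
    inferInstanceAs (Countable ((Σ n, L.Functions n) ⊕ Σ n, L.Relations n))
  exact ⟨hmc.homogenizable_of_seap hcat, hmc.seap_of_homogenizable hcat⟩

end HomPaper
end

section
/- If M is a structure over a finite relational vocabulary and ā ∈ M is a finite tuple such that tp(ā) is isolated by a quantifier-free formula, then the finite substructure A = M↾ā is an amalgamation base for Age(M). -/
open FirstOrder FirstOrder.Language CategoryTheory

namespace HomPaper

open Structure in
/-- A finite structure in a finite relational language has a diagram formula: the assignments
satisfying it are exactly the embeddings. -/
theorem exists_formula_realize_iff_embedding (L : FirstOrder.Language.{0, 0}) [L.IsRelational]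
    [Finite (Σ n : ℕ, L.Relations n)] (C : Type) [L.Structure C] [Finite C] :
    ∃ ψ : L.Formula C, ∀ (M : Type) [L.Structure M] (v : C → M),
      ψ.Realize v ↔ ∃ e : C ↪[L] M, ⇑e = v := by
  classical
  let relLiteral : (Σ r : (Σ n : ℕ, L.Relations n), Fin r.1 → C) → L.Formula C := fun q =>
    if RelMap q.1.2 q.2 then q.1.2.formula fun i => Term.var (q.2 i)
    else ∼(q.1.2.formula fun i => Term.var (q.2 i))
  let neLiteral : {q : C × C // q.1 ≠ q.2} → L.Formula C := fun q =>
    ∼((Term.var q.1.1).equal (Term.var q.1.2))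
  refine ⟨Formula.iInf relLiteral ⊓ Formula.iInf neLiteral, fun M _ v => ?_⟩
  rw [Formula.realize_inf, Formula.realize_iInf, Formula.realize_iInf]
  have relLiteral_realize (q) : (relLiteral q).Realize v ↔
      (RelMap q.1.2 (v ∘ q.2) ↔ RelMap q.1.2 q.2) := by
    by_cases hq : RelMap q.1.2 q.2 <;> simp [relLiteral, hq, Formula.realize_rel] <;> rfl
  have neLiteral_realize (q) : (neLiteral q).Realize v ↔ v q.1.1 ≠ v q.1.2 := by
    simp [neLiteral, Formula.realize_equal]
  simp only [relLiteral_realize, neLiteral_realize]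
  constructor
  · rintro ⟨hrel, hne⟩
    have hinj : Function.Injective v := fun x y hxy =>
      by_contra fun hne' => hne ⟨(x, y), hne'⟩ hxy
    exact ⟨{ toFun := v
             inj' := hinj
             map_fun' := fun f => isEmptyElim f
             map_rel' := fun r x => hrel ⟨⟨_, r⟩, x⟩ }, rfl⟩
  · rintro ⟨e, rfl⟩
    exact ⟨fun q => e.map_rel q.1.2 q.2, fun q => e.injective.ne q.2⟩

/-- An embedding of a finite structure into `M` can be moved along an equality of types. -/
theorem SameType.exists_embedding {L : FirstOrder.Language.{0, 0}} [L.IsRelational]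
    [Finite (Σ n : ℕ, L.Relations n)] {M : Type} [L.Structure M] {C : Type} [L.Structure C]
    [Finite C] {p : ℕ} {c : Fin p → C} {b : Fin p → M} (e : C ↪[L] M)
    (h : SameType L M (e ∘ c) b) : ∃ e' : C ↪[L] M, e' ∘ c = b := by
  obtain ⟨ψ, hψ⟩ := exists_formula_realize_iff_embedding L C
  let χ : L.Formula (Fin p) := Formula.iExs C
    (ψ.relabel Sum.inr ⊓
      Formula.iInf fun i => (Term.var (Sum.inr (c i))).equal (Term.var (Sum.inl i)))
  have χ_realize (d : Fin p → M) : χ.Realize d ↔ ∃ e' : C ↪[L] M, e' ∘ c = d := by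
    simp only [χ, Formula.realize_iExs, Formula.realize_inf, Formula.realize_relabel,
      Sum.elim_comp_inr, Formula.realize_iInf, Formula.realize_equal, Term.realize_var,
      Sum.elim_inl, Sum.elim_inr, hψ]
    constructor
    · rintro ⟨_, ⟨e', rfl⟩, he'⟩
      exact ⟨e', funext he'⟩
    · rintro ⟨e', rfl⟩
      exact ⟨e', ⟨e', rfl⟩, fun _ => rfl⟩
  exact (χ_realize b).1 ((h χ).1 ((χ_realize _).2 ⟨e, rfl⟩))

/-- Embeddings preserve and reflect quantifier-free formulas. -/
theorem realize_embedding_comp_iff {L : FirstOrder.Language.{0, 0}} {A M : Type} [L.Structure A]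
    [L.Structure M] {α : Type} {φ : L.Formula α} (hφ : φ.IsQF) (e : A ↪[L] M) (v : α → A) :
    φ.Realize (e ∘ v) ↔ φ.Realize v := by
  rw [Formula.Realize, Formula.Realize, ← hφ.realize_embedding e]
  exact iff_of_eq (congrArg _ (Subsingleton.elim _ _))

/-- If `tp(ā)` is isolated by a quantifier-free formula then the substructure
`M↾ā` is an amalgamation base for `Age(M)`. -/
theorem qfIsolated_isAmalgamationBase
    (L : FirstOrder.Language.{0, 0}) [L.IsRelational] [Finite (Σ n : ℕ, L.Relations n)]
    (M : Type) [L.Structure M] {p : ℕ} (a : Fin p → M)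
    (h : QFIsolated L M a) :
    IsAmalgamationBase L (FinAge L M) ↥(Substructure.closure L (Set.range a)) := by
  obtain ⟨φ, hφ, hφa, hiso⟩ := h
  rintro B C ⟨_, ⟨eB⟩⟩ ⟨_, ⟨eC⟩⟩ f g
  let A := Substructure.closure L (Set.range a)
  let a' : Fin p → A := fun i => ⟨a i, Substructure.subset_closure ⟨i, rfl⟩⟩
  have sameType (e : A ↪[L] M) : SameType L M a (e ∘ a') :=
    hiso _ ((realize_embedding_comp_iff hφ e a').2
      ((realize_embedding_comp_iff hφ A.subtype a').1 hφa))
  obtain ⟨eC', heC'⟩ : ∃ eC' : C ↪[L] M, eC' ∘ (g ∘ a') = eB ∘ f ∘ a' :=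
    SameType.exists_embedding eC fun χ =>
      (sameType (eC.comp g) χ).symm.trans (sameType (eB.comp f) χ)
  let S := Substructure.closure L (Set.range eB ∪ Set.range eC')
  have hS : Finite S :=
    (Substructure.fg_closure ((Set.finite_range eB).union (Set.finite_range eC'))).finite
  refine ⟨⟨S, inferInstance⟩, ⟨hS, ⟨S.subtype⟩⟩,
    eB.codRestrict S fun x => Substructure.subset_closure (Or.inl ⟨x, rfl⟩),
    eC'.codRestrict S fun x => Substructure.subset_closure (Or.inr ⟨x, rfl⟩), ?_⟩
  rintro ⟨x, hx⟩
  obtain ⟨i, rfl⟩ := (Substructure.mem_closure_iff_of_isRelational L _ x).1 hx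
  exact Subtype.ext (congrFun heC' i).symm

end HomPaper
end

section
/- Let M be an ω-categorical, model-complete structure over a finite relational vocabulary, let ā ∈ M be a finite tuple, and let A = M↾ā. If A is an amalgamation base for Age(M), then tp(ā) is isolated by a quantifier-free formula. -/
open FirstOrder FirstOrder.Language CategoryTheory

namespace HomPaper

section QuantifierFree

variable {L : FirstOrder.Language.{0, 0}}

theorem exists_isQF_realize_iff_forall {ι α : Type} [Finite ι] (ψ : ι → L.Formula α)
    (hψ : ∀ i, (ψ i).IsQF) :
    ∃ φ : L.Formula α, φ.IsQF ∧
      ∀ (M : Type) [L.Structure M] (v : α → M), φ.Realize v ↔ ∀ i, (ψ i).Realize v := by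
  refine ⟨Formula.iInf ψ, ?_, fun M _ v => Formula.realize_iInf⟩
  suffices ∀ l : List ι, ((l.map ψ).foldr (· ⊓ ·) (⊤ : L.Formula α)).IsQF from this _
  intro l
  induction l with
  | nil => exact BoundedFormula.IsQF.top
  | cons i l ih => exact (hψ i).inf ih

/-- The quantifier-free type of a finite tuple over a finite relational language is given by a
single quantifier-free formula. -/
theorem exists_isQF_sameAtomic [Finite (Σ n : ℕ, L.Relations n)] (M : Type) [L.Structure M]
    {p : ℕ} (a : Fin p → M) :
    ∃ φ : L.Formula (Fin p), φ.IsQF ∧ φ.Realize a ∧ ∀ b : Fin p → M, φ.Realize b →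
      (∀ i j, a i = a j ↔ b i = b j) ∧
      ∀ {n : ℕ} (r : L.Relations n) (x : Fin n → Fin p),
        Structure.RelMap r (a ∘ x) ↔ Structure.RelMap r (b ∘ x) := by
  classical
  let atom : (Fin p × Fin p) ⊕ (Σ r : (Σ n : ℕ, L.Relations n), (Fin r.1 → Fin p)) →
      L.Formula (Fin p) :=
    Sum.elim (fun ij => (Term.var ij.1).equal (Term.var ij.2))
      (fun rx => rx.1.2.formula fun i => Term.var (rx.2 i))
  have hatom : ∀ i, (atom i).IsQF := by
    rintro (i | i)
    · exact (BoundedFormula.IsAtomic.equal _ _).isQF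
    · exact (BoundedFormula.IsAtomic.rel _ _).isQF
  obtain ⟨φ, hφ, hreal⟩ := exists_isQF_realize_iff_forall
    (fun i => if (atom i).Realize a then atom i else (atom i).not) (fun i => by
      split_ifs
      · exact hatom i
      · exact (hatom i).not)
  refine ⟨φ, hφ, (hreal M a).2 fun i => ?_, fun b hb => ?_⟩
  · split_ifs with h
    · exact h
    · exact Formula.realize_not.2 h
  · have key : ∀ i, (atom i).Realize a ↔ (atom i).Realize b := fun i => by
      have := (hreal M b).1 hb i
      split_ifs at this with h
      · exact iff_of_true h this
      · exact iff_of_false h (Formula.realize_not.1 this)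
    refine ⟨fun i j => ?_, fun {n} r x => ?_⟩
    · simpa [atom] using key (Sum.inl (i, j))
    · simpa only [atom, Sum.elim_inr, Formula.realize_rel, Term.realize_var, Function.comp_def] using
        key (Sum.inr ⟨⟨n, r⟩, x⟩)

end QuantifierFree

section EmbedsOn

/-- `f` restricts to an embedding of the substructure induced on `S`. -/
structure EmbedsOn (L : FirstOrder.Language.{0, 0}) {M : Type} [L.Structure M]
    (S : Set M) (f : M → M) : Prop where
  injOn : Set.InjOn f S
  map_rel : ∀ {n : ℕ} (r : L.Relations n) (x : Fin n → M), (∀ i, x i ∈ S) →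
    (Structure.RelMap r (f ∘ x) ↔ Structure.RelMap r x)

theorem exists_embedsOn_of_embedding {L : FirstOrder.Language.{0, 0}} {M : Type}
    [L.Structure M] (S : L.Substructure M) (e : S ↪[L] M) :
    ∃ f : M → M, EmbedsOn L (S : Set M) f ∧ ∀ x : S, f x = e x := by
  classical
  let f : M → M := fun x => if hx : x ∈ S then e ⟨x, hx⟩ else x
  have hf : ∀ x : S, f x = e x := fun x => dif_pos x.2
  refine ⟨f, ⟨fun x hx y hy hxy => ?_, fun r x hx => ?_⟩, hf⟩
  · have := e.injective ((hf ⟨x, hx⟩).symm.trans (hxy.trans (hf ⟨y, hy⟩)))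
    exact congrArg Subtype.val this
  · have hfx : f ∘ x = e ∘ fun i => (⟨x i, hx i⟩ : S) := funext fun i => hf ⟨x i, hx i⟩
    rw [hfx]
    exact e.map_rel r _

end EmbedsOn

section Amalgamation

variable {L : FirstOrder.Language.{0, 0}} [L.IsRelational] {M : Type} [L.Structure M]

/-- Two tuples with the same quantifier-free type induce an embedding of the substructure
generated by the first, sending it to the second. -/
theorem exists_embedding_closure_range {p : ℕ} {a b : Fin p → M}
    (heq : ∀ i j, a i = a j ↔ b i = b j)
    (hrel : ∀ {n : ℕ} (r : L.Relations n) (x : Fin n → Fin p),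
        Structure.RelMap r (a ∘ x) ↔ Structure.RelMap r (b ∘ x)) :
    ∃ e : ↥(Substructure.closure L (Set.range a)) ↪[L] M,
      ∀ (i : Fin p) (hi : a i ∈ Substructure.closure L (Set.range a)), e ⟨a i, hi⟩ = b i := by
  have hmem : ∀ x : ↥(Substructure.closure L (Set.range a)), ∃ i, a i = x := fun x =>
    (Substructure.mem_closure_iff_of_isRelational L (Set.range a) (x : M)).1 x.2
  choose idx hidx using hmem
  refine ⟨⟨⟨fun x => b (idx x), fun x y hxy => ?_⟩, fun f => isEmptyElim f, fun r x => ?_⟩,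
    fun i hi => ?_⟩
  · exact Subtype.ext (by rw [← hidx x, ← hidx y]; exact (heq _ _).2 hxy)
  · refine (hrel r (idx ∘ x)).symm.trans ?_
    have hx : a ∘ idx ∘ x = Subtype.val ∘ x := funext fun i => hidx (x i)
    rw [hx]
    exact Iff.rfl
  · exact (heq _ _).1 (hidx ⟨a i, hi⟩)

theorem mem_finAge_closure {S : Set M} (hS : S.Finite) :
    (Bundled.of ↥(Substructure.closure L S) : Bundled.{0} L.Structure) ∈ FinAge L M := by
  refine ⟨?_, ⟨(Substructure.closure L S).subtype⟩⟩
  change Finite ((Substructure.closure L S : L.Substructure M) : Set M)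
  rw [Substructure.closure_eq_of_isRelational]
  exact hS

/-- If `a` generates an amalgamation base and `b` has the same quantifier-free type, then
finite parts of two copies of `M` amalgamate inside `M` over the identification of `a` with `b`. -/
theorem IsAmalgamationBase.exists_embedsOn {p : ℕ} {a b : Fin p → M}
    (h : IsAmalgamationBase L (FinAge L M) ↥(Substructure.closure L (Set.range a)))
    (heq : ∀ i j, a i = a j ↔ b i = b j)
    (hrel : ∀ {n : ℕ} (r : L.Relations n) (x : Fin n → Fin p),
        Structure.RelMap r (a ∘ x) ↔ Structure.RelMap r (b ∘ x))
    {S : Set M} (hS : S.Finite) :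
    ∃ f g : M → M, EmbedsOn L S f ∧ EmbedsOn L S g ∧ ∀ i, f (a i) = g (b i) := by
  obtain ⟨e, he⟩ := exists_embedding_closure_range heq hrel
  have hmem : ∀ i, a i ∈ Substructure.closure L (Set.range a) := fun i =>
    Substructure.subset_closure ⟨i, rfl⟩
  let T : Set M := S ∪ (Set.range a ∪ Set.range b)
  have hT : T.Finite := hS.union ((Set.finite_range a).union (Set.finite_range b))
  let B : L.Substructure M := Substructure.closure L T
  have hTB : T ⊆ B := Substructure.subset_closure
  have haB : Substructure.closure L (Set.range a) ≤ B :=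
    Substructure.closure_mono fun x hx => Or.inr (Or.inl hx)
  have heB : ∀ x, e x ∈ B := by
    rintro ⟨x, hx⟩
    obtain ⟨i, rfl⟩ := (Substructure.mem_closure_iff_of_isRelational L _ _).1 hx
    rw [he i hx]
    exact hTB (Or.inr (Or.inr ⟨i, rfl⟩))
  obtain ⟨D, ⟨-, ⟨d⟩⟩, f₀, g₀, hfg⟩ := h (Bundled.of ↥B) (Bundled.of ↥B)
    (mem_finAge_closure hT) (mem_finAge_closure hT)
    (Substructure.inclusion haB) (e.codRestrict B heB)
  obtain ⟨f, hf, hf'⟩ := exists_embedsOn_of_embedding B (d.comp f₀)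
  obtain ⟨g, hg, hg'⟩ := exists_embedsOn_of_embedding B (d.comp g₀)
  have hSB : S ⊆ B := fun x hx => hTB (Or.inl hx)
  refine ⟨f, g, ⟨hf.injOn.mono hSB, fun r x hx => hf.map_rel r x fun i => hSB (hx i)⟩,
    ⟨hg.injOn.mono hSB, fun r x hx => hg.map_rel r x fun i => hSB (hx i)⟩, fun i => ?_⟩
  have hb : b i ∈ B := hTB (Or.inr (Or.inr ⟨i, rfl⟩))
  have hgb : e.codRestrict B heB ⟨a i, hmem i⟩ = ⟨b i, hb⟩ := Subtype.ext (he i (hmem i))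
  have hi := congrArg d ((hfg ⟨a i, hmem i⟩).trans (congrArg g₀ hgb))
  exact (hf' ⟨a i, haB (hmem i)⟩).trans (hi.trans (hg' ⟨b i, hb⟩).symm)

end Amalgamation

section Ultrapower

open Filter

variable {L : FirstOrder.Language.{0, 0}} [L.IsRelational] {M : Type} [L.Structure M]

/-- Maps embedding larger and larger finite subsets of `M` into `M` assemble to an embedding of
`M` into an ultrapower. -/
theorem exists_embedding_ultrapower {u : Ultrafilter (Finset M)}
    (hu : (u : Filter (Finset M)) ≤ atTop)
    {f : Finset M → M → M} (hf : ∀ s : Finset M, EmbedsOn L (s : Set M) (f s)) :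
    ∃ e : M ↪[L] (u : Filter (Finset M)).Product (fun _ => M),
      ∀ x, e x = ((fun s => f s x : Finset M → M) : (u : Filter (Finset M)).Product _) := by
  classical
  have hmem : ∀ t : Finset M, ∀ᶠ s in (u : Filter (Finset M)), t ⊆ s := fun t =>
    hu (mem_atTop t)
  refine ⟨⟨⟨fun x => ((fun s => f s x : Finset M → M) : (u : Filter (Finset M)).Product _),
    fun x y hxy => ?_⟩, fun f => isEmptyElim f, fun {n} r x => ?_⟩, fun x => rfl⟩
  · have hxy' : ∀ᶠ s in (u : Filter (Finset M)), f s x = f s y := Quotient.exact hxy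
    obtain ⟨s, hs, hst⟩ := (hxy'.and (hmem {x, y})).exists
    exact (hf s).injOn (hst (by simp)) (hst (by simp)) hs
  · have hrel : ∀ᶠ s in (u : Filter (Finset M)),
        (Structure.RelMap r (f s ∘ x) ↔ Structure.RelMap r x) :=
      (hmem (Finset.univ.image x)).mono fun s hs =>
        (hf s).map_rel r x fun i => hs (Finset.mem_image_of_mem x (Finset.mem_univ i))
    have hquot : Structure.RelMap r (fun i =>
        ((fun s => f s (x i) : Finset M → M) : (u : Filter (Finset M)).Product fun _ => M)) ↔
        ∀ᶠ s in (u : Filter (Finset M)), Structure.RelMap r (f s ∘ x) :=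
      relMap_quotient_mk' (s := (u : Filter (Finset M)).productSetoid fun _ => M) r
        fun i s => f s (x i)
    refine hquot.trans ((eventually_congr hrel).trans ?_)
    exact eventually_const

end Ultrapower

/-- For ω-categorical model-complete `M`, if `M↾ā` is an amalgamation base for
`Age(M)` then `tp(ā)` is isolated by a quantifier-free formula. -/
theorem isAmalgamationBase_qfIsolated
    (L : FirstOrder.Language.{0, 0}) [L.IsRelational] [Finite (Σ n : ℕ, L.Relations n)]
    (M : Type) [L.Structure M]
    (hcat : OmegaCategorical L M) (hmc : ModelComplete L M)
    {p : ℕ} (a : Fin p → M)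
    (h : IsAmalgamationBase L (FinAge L M) ↥(Substructure.closure L (Set.range a))) :
    QFIsolated L M a := by
  obtain ⟨φ, hφ, hφa, hφb⟩ := exists_isQF_sameAtomic (L := L) M a
  refine ⟨φ, hφ, hφa, fun b hb ψ => ?_⟩
  obtain ⟨heq, hrel⟩ := hφb b hb
  rcases isEmpty_or_nonempty M with hM | hM
  · rw [Subsingleton.elim a b]
  choose f g hf hg hfg using fun s : Finset M =>
    IsAmalgamationBase.exists_embedsOn h heq hrel s.finite_toSet
  let u : Ultrafilter (Finset M) := Ultrafilter.of Filter.atTop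
  obtain ⟨e, he⟩ := exists_embedding_ultrapower (u := u) (Ultrafilter.of_le _) hf
  obtain ⟨e', he'⟩ := exists_embedding_ultrapower (u := u) (Ultrafilter.of_le _) hg
  have hmodel : (u : Filter (Finset M)).Product (fun _ => M) ⊨ L.completeTheory M :=
    ⟨fun σ hσ => (Ultraproduct.sentence_realize σ).2 (Filter.Eventually.of_forall fun _ => hσ)⟩
  let N₁ : (L.completeTheory M).ModelType := Theory.ModelType.of _ M
  let N₂ : (L.completeTheory M).ModelType :=
    Theory.ModelType.of _ ((u : Filter (Finset M)).Product fun _ => M)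
  have hab : (fun i => e (a i)) = fun i => e' (b i) := funext fun i => by
    simp only [he, he', hfg]
    rfl
  have h₁ := hmc N₁ N₂ e p ψ a
  have h₂ := hmc N₁ N₂ e' p ψ b
  exact h₁.symm.trans ((iff_of_eq (congrArg ψ.Realize hab)).trans h₂)

end HomPaper
end

section
/- If M is a homogenizable, model-complete structure over a finite relational vocabulary, then M is Σ1-homogenizable, every complete type over ∅ realized in M is isolated by a conjunction of homogenizing formulas and quantifier-free formulas, and Age(M) satisfies SEAP. -/
open FirstOrder FirstOrder.Language CategoryTheory

namespace HomPaper

section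

open Structure Filter

variable {L : FirstOrder.Language.{0, 0}} {M : Type} [L.Structure M]

/-- The tuples `a` and `b` satisfy the same equalities and the same relations. -/
def SameAtomicDiagram (L : FirstOrder.Language.{0, 0}) {M N : Type} [L.Structure M]
    [L.Structure N] {ι : Type} (a : ι → M) (b : ι → N) : Prop :=
  (∀ i j, a i = a j ↔ b i = b j) ∧
    ∀ (r : Σ n : ℕ, L.Relations n) (t : Fin r.1 → ι), RelMap r.2 (a ∘ t) ↔ RelMap r.2 (b ∘ t)

namespace SameAtomicDiagram

variable {N P : Type} [L.Structure N] [L.Structure P] {ι κ : Type}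

theorem symm {a : ι → M} {b : ι → N} (h : SameAtomicDiagram L a b) : SameAtomicDiagram L b a :=
  ⟨fun i j => (h.1 i j).symm, fun r t => (h.2 r t).symm⟩

theorem trans {a : ι → M} {b : ι → N} {c : ι → P} (h : SameAtomicDiagram L a b)
    (h' : SameAtomicDiagram L b c) : SameAtomicDiagram L a c :=
  ⟨fun i j => (h.1 i j).trans (h'.1 i j), fun r t => (h.2 r t).trans (h'.2 r t)⟩

theorem comp {a : ι → M} {b : ι → N} (h : SameAtomicDiagram L a b) (e : κ → ι) :
    SameAtomicDiagram L (a ∘ e) (b ∘ e) :=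
  ⟨fun i j => h.1 (e i) (e j), fun r t => h.2 r (e ∘ t)⟩

theorem of_embedding (f : M ↪[L] N) (a : ι → M) : SameAtomicDiagram L a (f ∘ a) :=
  ⟨fun _ _ => f.injective.eq_iff.symm, fun r t => (f.map_rel r.2 (a ∘ t)).symm⟩

/-- The embedding of a structure for a relational language given by a map that preserves and
reflects equalities and relations. -/
def toEmbedding [L.IsRelational] {f : M → N} (h : SameAtomicDiagram L id f) : M ↪[L] N where
  toFun := f
  inj' _ _ hxy := (h.1 _ _).2 hxy
  map_fun' g := isEmptyElim g
  map_rel' r x := (h.2 ⟨_, r⟩ x).symm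

end SameAtomicDiagram

namespace SameType

theorem symm {p : ℕ} {a b : Fin p → M} (h : SameType L M a b) : SameType L M b a :=
  fun φ => (h φ).symm

theorem trans {p : ℕ} {a b c : Fin p → M} (h : SameType L M a b) (h' : SameType L M b c) :
    SameType L M a c :=
  fun φ => (h φ).trans (h' φ)

theorem of_equiv {p : ℕ} {a b : Fin p → M} (g : M ≃[L] M) (h : ∀ i, g (a i) = b i) :
    SameType L M a b := by
  intro φ
  rw [← StrongHomClass.realize_formula g φ, show g ∘ a = b from funext h]

end SameType

/-- The tuples `a` and `b` have the same atomic diagram in the expansion of `M` by `φ`. -/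
def SameExpDiagram {n : ℕ} {k : Fin n → ℕ} (φ : ∀ i : Fin n, L.Formula (Fin (k i)))
    {ι : Type} (a b : ι → M) : Prop :=
  SameAtomicDiagram L a b ∧ ∀ i (t : Fin (k i) → ι), (φ i).Realize (a ∘ t) ↔ (φ i).Realize (b ∘ t)

section Homogenizes

variable [L.IsRelational] {n : ℕ} {k : Fin n → ℕ} {φ : ∀ i : Fin n, L.Formula (Fin (k i))}

instance isRelational_expLang : (expLang n k).IsRelational :=
  fun _ => inferInstanceAs (IsEmpty Empty)

/-- In a homogenized structure, finite tuples with the same expanded atomic diagram are conjugate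
under the automorphism group. -/
theorem Homogenizes.exists_equiv (h : Homogenizes L M φ) {ι : Type} [Finite ι] {a b : ι → M}
    (hab : SameExpDiagram φ a b) : ∃ g : M ≃[L] M, ∀ i, g (a i) = b i := by
  let _ : (expLang n k).Structure M := expStructure L M φ
  let S : (L.sum (expLang n k)).Substructure M := Substructure.closure _ (Set.range a)
  have hS : ∀ x : S, ∃ i, a i = x := fun x =>
    Set.mem_range.1 <|
    (Substructure.mem_closure_iff_of_isRelational _ _ (x : M)).1 x.2
  choose c hc using hS
  have hac : ∀ {m : ℕ} (x : Fin m → S), a ∘ c ∘ x = S.subtype ∘ x := fun x =>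
    funext fun i => hc (x i)
  let f : S ↪[L.sum (expLang n k)] M :=
    { toFun := fun x => b (c x)
      inj' := fun x y hxy => Subtype.ext (by rw [← hc x, ← hc y]; exact (hab.1.1 _ _).2 hxy)
      map_fun' := fun F => isEmptyElim F
      map_rel' := fun {m} r x => by
        rw [← S.subtype.map_rel, ← hac]
        rcases r with r | ⟨i, rfl⟩
        · exact (hab.1.2 ⟨_, r⟩ (c ∘ x)).symm
        · exact (hab.2 i (c ∘ x)).symm }
  obtain ⟨g, hg⟩ := h S (Substructure.fg_closure (Set.finite_range a)) f
  refine ⟨⟨g.toEquiv, fun F => isEmptyElim F, fun r x => g.map_rel (Sum.inl r) x⟩, fun i => ?_⟩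
  have hi : a i ∈ S := Substructure.subset_closure ⟨i, rfl⟩
  have h1 : b (c ⟨a i, hi⟩) = g (a i) := DFunLike.congr_fun hg (⟨a i, hi⟩ : S)
  exact h1.symm.trans ((hab.1.1 _ _).1 (hc ⟨a i, hi⟩))

theorem homogenizes_of_exists_equiv
    (h : ∀ (ι : Type) [Finite ι] (a b : ι → M), SameExpDiagram φ a b →
      ∃ g : M ≃[L] M, ∀ i, g (a i) = b i) : Homogenizes L M φ := by
  let _ : (expLang n k).Structure M := expStructure L M φ
  intro S hS f
  obtain ⟨s, hs⟩ := hS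
  have hSs : (S : Set M) = s := by
    rw [← hs, Substructure.closure_eq_of_isRelational]
  have : Finite S := by
    have : Finite (S : Set M) := by rw [hSs]; exact s.finite_toSet
    exact this
  obtain ⟨g, hg⟩ := h S S.subtype f ⟨⟨fun x y => by
      rw [S.subtype.injective.eq_iff, f.injective.eq_iff], fun r t => by
      exact (S.subtype.map_rel (Sum.inl r.2) t).trans (f.map_rel (Sum.inl r.2) t).symm⟩,
    fun i t => by
      exact (S.subtype.map_rel (Sum.inr ⟨i, rfl⟩ : (L.sum (expLang n k)).Relations (k i)) t).trans
        (f.map_rel (Sum.inr ⟨i, rfl⟩ : (L.sum (expLang n k)).Relations (k i)) t).symm⟩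
  refine ⟨⟨g.toEquiv, fun F => isEmptyElim F, fun {m} r x => ?_⟩, ?_⟩
  · rcases r with r | ⟨i, rfl⟩
    · exact g.map_rel r x
    · exact StrongHomClass.realize_formula g (φ i)
  · ext x
    exact (hg x).symm

theorem Homogenizes.sameType (h : Homogenizes L M φ) {p : ℕ} {a b : Fin p → M}
    (hab : SameExpDiagram φ a b) : SameType L M a b :=
  let ⟨g, hg⟩ := h.exists_equiv hab
  .of_equiv g hg

/-- A homogenized structure realizes only finitely many `p`-types. -/
theorem Homogenizes.exists_finite_representatives [Finite (Σ n : ℕ, L.Relations n)]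
    (h : Homogenizes L M φ) (p : ℕ) :
    ∃ (J : Type) (_ : Finite J) (r : J → Fin p → M), ∀ a, ∃ j, SameType L M (r j) a := by
  let code : (Fin p → M) → (Fin p × Fin p → Prop) ×
      ((Σ r : (Σ n : ℕ, L.Relations n), Fin r.1 → Fin p) → Prop) ×
      ((Σ i : Fin n, Fin (k i) → Fin p) → Prop) := fun a =>
    (fun e => a e.1 = a e.2, fun e => RelMap e.1.2 (a ∘ e.2), fun e => (φ e.1).Realize (a ∘ e.2))
  choose r hr using fun x : Set.range code => x.2
  refine ⟨Set.range code, inferInstance, r, fun a => ⟨⟨code a, a, rfl⟩, h.sameType ?_⟩⟩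
  have hc := hr ⟨code a, a, rfl⟩
  simp only [code, Prod.mk.injEq, funext_iff, eq_iff_iff] at hc
  exact ⟨⟨fun i j => hc.1 (i, j), fun r t => hc.2.1 ⟨r, t⟩⟩, fun i t => hc.2.2 ⟨i, t⟩⟩

end Homogenizes

/-- The tuple `w` witnesses the type of `a`: the atomic diagram of `(a, w)` determines it. -/
def Witnesses (L : FirstOrder.Language.{0, 0}) {M : Type} [L.Structure M] {p : ℕ} {κ : Type}
    (a : Fin p → M) (w : κ → M) : Prop :=
  ∀ (b : Fin p → M) (w' : κ → M),
    SameAtomicDiagram L (Sum.elim a w) (Sum.elim b w') → SameType L M a b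

/-- In a model-complete structure with finitely many `p`-types, every `p`-type is determined by
the atomic diagram of a finite extension of a realization. -/
theorem ModelComplete.exists_witnesses [L.IsRelational] (hmc : ModelComplete L M) {p : ℕ}
    {J : Type} [Finite J] {r : J → Fin p → M} (hr : ∀ a, ∃ j, SameType L M (r j) a)
    (a : Fin p → M) : ∃ (κ : Type) (_ : Finite κ) (w : κ → M), Witnesses L a w := by
  rcases isEmpty_or_nonempty M with hM | hM
  · exact ⟨Empty, inferInstance, Empty.elim, fun b _ _ φ => by rw [Subsingleton.elim a b]⟩
  by_contra! hcon
  have hS : ∀ S : Finset M, ∃ (b : Fin p → M) (h : S → M),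
      SameAtomicDiagram L (Sum.elim a (fun x : S => (x : M))) (Sum.elim b h) ∧
        ¬ SameType L M a b := by
    intro S
    have := hcon S inferInstance (fun x => x)
    simp only [Witnesses] at this
    push Not at this
    exact this
  choose b h hbh hne using hS
  classical
  let U : Ultrafilter (Finset M) := Ultrafilter.of atTop
  have hU : (U : Filter (Finset M)) ≤ atTop := Ultrafilter.of_le _
  let N : Type := (U : Filter (Finset M)).Product fun _ => M
  have : N ⊨ L.completeTheory M := by
    refine ⟨fun φ hφ => ?_⟩
    refine (Ultraproduct.sentence_realize φ).2 ?_
    exact Eventually.of_forall fun _ => hφ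
  let G : M → Finset M → M := fun m S => if hm : m ∈ S then h S ⟨m, hm⟩ else m
  have hG : ∀ {m S} (hm : m ∈ S), G m S = h S ⟨m, hm⟩ := fun hm => dif_pos hm
  let g : M → N := fun m => ((G m : Finset M → M) : (U : Filter (Finset M)).Product fun _ => M)
  have hmem : ∀ s : Finset M, ∀ᶠ S in (U : Filter (Finset M)), s ⊆ S :=
    fun s => hU (eventually_ge_atTop s)
  have hdiag : ∀ {q : ℕ} (ψ : L.Formula (Fin q)) (x : Fin q → M),
      (ψ.Realize (fun i => g (x i))) ↔
        ∀ᶠ S in (U : Filter (Finset M)), ψ.Realize fun i => G (x i) S :=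
    fun ψ x => Ultraproduct.realize_formula_cast ψ _
  have hatom : ∀ {q : ℕ} (x : Fin q → M), ∀ᶠ S in (U : Filter (Finset M)),
      SameAtomicDiagram L x (fun i => G (x i) S) := by
    intro q x
    filter_upwards [hmem (Finset.univ.image x)] with S hS
    have hx : ∀ i, x i ∈ S := fun i => hS (Finset.mem_image_of_mem _ (Finset.mem_univ i))
    rw [show (fun i => G (x i) S) = fun i => h S ⟨x i, hx i⟩ from funext fun i => hG (hx i)]
    exact (hbh S).comp fun i : Fin q => Sum.inr ⟨x i, hx i⟩
  have hgd : SameAtomicDiagram L id g := by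
    constructor
    · intro x y
      have h1 := hdiag ((Term.var 0).equal (Term.var 1) : L.Formula (Fin 2)) ![x, y]
      simp only [Formula.realize_equal, Term.realize_var] at h1
      refine Iff.trans ?_ h1.symm
      have h2 : ∀ᶠ S in (U : Filter (Finset M)), (x = y ↔ G x S = G y S) :=
        (hatom ![x, y]).mono fun S hS => hS.1 0 1
      constructor
      · intro hxy
        exact h2.mono fun S hS => hS.1 hxy
      · intro hxy
        obtain ⟨S, hS, hS'⟩ := (h2.and hxy).exists
        exact hS.2 hS'
    · rintro ⟨m, R⟩ t
      have h1 := hdiag (R.formula fun i => Term.var i) t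
      simp only [Formula.realize_rel, Term.realize_var] at h1
      refine Iff.trans ?_ h1.symm
      have h2 := (hatom t).mono fun S hS => hS.2 ⟨m, R⟩ id
      constructor
      · intro hxy
        exact h2.mono fun S hS => hS.1 hxy
      · intro hxy
        obtain ⟨S, hS, hS'⟩ := (h2.and hxy).exists
        exact hS.2 hS'
  have helem : ∀ ψ : L.Formula (Fin p), ψ.Realize a ↔
      ∀ᶠ S in (U : Filter (Finset M)), ψ.Realize (b S) := by
    intro ψ
    have h1 := hmc (.of _ M) (.of _ N) hgd.toEmbedding p ψ a
    refine h1.symm.trans ((hdiag ψ a).trans (eventually_congr ?_))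
    filter_upwards [hmem (Finset.univ.image a)] with S hS
    have ha : ∀ i, a i ∈ S := fun i => hS (Finset.mem_image_of_mem _ (Finset.mem_univ i))
    have : (fun i => G (a i) S) = b S := funext fun i =>
      (hG (ha i)).trans (((hbh S).1 (Sum.inl i) (Sum.inr ⟨a i, ha i⟩)).1 rfl).symm
    rw [this]
  choose j hj using fun S => hr (b S)
  obtain ⟨j₀, hj₀⟩ : ∃ j₀, ∀ᶠ S in (U : Filter (Finset M)), j S = j₀ := by
    by_contra! hnone
    have h1 : ∀ᶠ S in (U : Filter (Finset M)), ∀ j₀, ¬ j S = j₀ :=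
      eventually_all.2 hnone
    obtain ⟨S, hS⟩ := h1.exists
    exact hS _ rfl
  have hfin : ∀ ψ : L.Formula (Fin p), ψ.Realize a ↔ ψ.Realize (r j₀) := fun ψ => by
    rw [helem ψ, eventually_congr (hj₀.mono fun S hS => by rw [← hj S ψ, hS]),
      eventually_const]
  obtain ⟨S, hS⟩ := hj₀.exists
  exact hne S (SameType.trans hfin (hS ▸ hj S))

/-- The atomic diagram of a finite tuple is expressed by a quantifier-free formula. -/
theorem exists_isQF_realize_iff_sameAtomicDiagram [Finite (Σ n : ℕ, L.Relations n)] {ι : Type}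
    [Finite ι] (a : ι → M) :
    ∃ χ : L.Formula ι, χ.IsQF ∧ ∀ b : ι → M, χ.Realize b ↔ SameAtomicDiagram L a b := by
  classical
  let lit : (ι × ι) ⊕ (Σ r : (Σ n : ℕ, L.Relations n), Fin r.1 → ι) → L.Formula ι :=
    Sum.elim (fun e => (Term.var e.1).equal (Term.var e.2))
      fun e => e.1.2.formula fun i => Term.var (e.2 i)
  have hlit : ∀ e, (lit e).IsQF := by
    rintro (e | e)
    · exact (BoundedFormula.IsAtomic.equal _ _).isQF
    · exact (BoundedFormula.IsAtomic.rel _ _).isQF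
  let f e : L.Formula ι := if (lit e).Realize a then lit e else (lit e).not
  have hf : ∀ e, (f e).IsQF := fun e => by
    by_cases h : (lit e).Realize a
    · simpa only [f, if_pos h] using hlit e
    · simpa only [f, if_neg h] using (hlit e).not
  have hfr : ∀ e (b : ι → M), (f e).Realize b ↔ ((lit e).Realize a ↔ (lit e).Realize b) := by
    intro e b
    by_cases h : (lit e).Realize a
    · simp only [f, if_pos h, h, true_iff]
    · simp only [f, if_neg h, h, false_iff, Formula.realize_not]
  refine ⟨Formula.iInf f, ?_, fun b => ?_⟩
  · have hfold : ∀ l : List (L.Formula ι), (∀ ψ ∈ l, ψ.IsQF) →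
        (l.foldr (· ⊓ ·) (⊤ : L.Formula ι)).IsQF := by
      intro l
      induction l with
      | nil => exact fun _ => BoundedFormula.IsQF.top
      | cons ψ l ih =>
        intro hl
        exact (hl ψ (by simp)).inf (ih fun ψ' h' => hl ψ' (by simp [h']))
    refine hfold _ fun ψ hψ => ?_
    obtain ⟨e, -, rfl⟩ := List.mem_map.1 hψ
    exact hf e
  · rw [Formula.realize_iInf]
    simp only [hfr, Sum.forall]
    refine and_congr ?_ ?_
    · simp [lit, Prod.forall]
    · simp [lit, Sigma.forall, Function.comp_def]

theorem isSigma1_iExs {p : ℕ} {κ : Type} [Finite κ] {χ : L.Formula (Fin p ⊕ κ)} (hχ : χ.IsQF) :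
    IsSigma1 L (χ.iExs κ) :=
  ⟨_, _, hχ.relabel _, rfl⟩

/-- A witnessed type is isolated by a `Σ₁`-formula, and any realization of that formula is itself
witnessed by a tuple of the same length. -/
theorem Witnesses.exists_isSigma1 [Finite (Σ n : ℕ, L.Relations n)] {p : ℕ} {κ : Type} [Finite κ]
    {a : Fin p → M} {w : κ → M} (h : Witnesses L a w) :
    ∃ θ : L.Formula (Fin p), IsSigma1 L θ ∧ (∀ b : Fin p → M, θ.Realize b ↔ SameType L M a b) ∧
      ∀ b : Fin p → M, SameType L M a b → ∃ w' : κ → M, Witnesses L b w' := by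
  obtain ⟨χ, hχ, hχr⟩ := exists_isQF_realize_iff_sameAtomicDiagram (L := L) (Sum.elim a w)
  have hθ : ∀ b : Fin p → M, (χ.iExs κ).Realize b ↔
      ∃ w' : κ → M, SameAtomicDiagram L (Sum.elim a w) (Sum.elim b w') := fun b => by
    rw [Formula.realize_iExs]
    exact exists_congr fun w' => hχr _
  have ha : (χ.iExs κ).Realize a := (hθ a).2 ⟨w, fun _ _ => Iff.rfl, fun _ _ => Iff.rfl⟩
  refine ⟨χ.iExs κ, isSigma1_iExs hχ, fun b => ⟨fun hb => ?_, fun hb => (hb _).1 ha⟩,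
    fun b hb => ?_⟩
  · obtain ⟨w', hw'⟩ := (hθ b).1 hb
    exact h b w' hw'
  · obtain ⟨w', hw'⟩ := (hθ b).1 ((hb _).1 ha)
    exact ⟨w', fun c w'' hc => hb.symm.trans (h c w'' (hw'.trans hc))⟩

/-- The conclusion of `Witnesses` for embeddings of a substructure containing the tuples. -/
theorem Witnesses.sameType_embedding {p : ℕ} {κ : Type} {a : Fin p → M} {w : κ → M}
    (h : Witnesses L a w) {B : L.Substructure M} (ha : ∀ i, a i ∈ B) (hw : ∀ i, w i ∈ B)
    (f : B ↪[L] M) : SameType L M a fun i => f ⟨a i, ha i⟩ := by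
  refine h _ (fun i => f ⟨w i, hw i⟩) ?_
  let c : Fin p ⊕ κ → B := Sum.elim (fun i => ⟨a i, ha i⟩) fun i => ⟨w i, hw i⟩
  have h1 := (SameAtomicDiagram.of_embedding B.subtype c).symm.trans (.of_embedding f c)
  convert h1 using 1
  · funext i; rcases i with i | i <;> rfl
  · funext i; rcases i with i | i <;> rfl

/-- The image of a finite `B` and a finite tuple `w` lie in a substructure of `M` with at most
`|B| + |w|` elements. -/
theorem exists_extension [L.IsRelational] {B : Type} [L.Structure B] [Finite B] (β : B ↪[L] M)
    {κ : Type} [Finite κ] (w : κ → M) :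
    ∃ B0 : L.Substructure M, Finite B0 ∧ (∀ x, β x ∈ B0) ∧ (∀ i, w i ∈ B0) ∧
      Nat.card B0 ≤ Nat.card B + Nat.card κ := by
  have hB0 := Substructure.closure_eq_of_isRelational L (Set.range β ∪ Set.range w)
  refine ⟨Substructure.closure L (Set.range β ∪ Set.range w), ?_, fun x =>
    Substructure.subset_closure (Or.inl ⟨x, rfl⟩), fun i =>
    Substructure.subset_closure (Or.inr ⟨i, rfl⟩), ?_⟩
  · have : Finite (Substructure.closure L (Set.range β ∪ Set.range w) : Set M) := by
      rw [hB0]; infer_instance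
    exact this
  · have h1 : Nat.card (Substructure.closure L (Set.range β ∪ Set.range w)) =
        (Set.range β ∪ Set.range w).ncard := by
      rw [← Nat.card_coe_set_eq]
      conv_rhs => rw [← hB0]
      rfl
    rw [h1]
    refine (Set.ncard_union_le _ _).trans (add_le_add ?_ ?_)
    · rw [← Nat.card_coe_set_eq]; exact Finite.card_range_le _
    · rw [← Nat.card_coe_set_eq]; exact Finite.card_range_le _

/-- Two conjugate embeddings into `M` have an amalgam in the age of `M`. -/
theorem hasAmalgam_of_equiv [L.IsRelational] {A B C : Type} [L.Structure A] [L.Structure B]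
    [L.Structure C] [Finite B] [Finite C] {f : A ↪[L] B} {g : A ↪[L] C} (β : B ↪[L] M)
    (γ : C ↪[L] M) (σ : M ≃[L] M) (h : ∀ x, σ (β (f x)) = γ (g x)) :
    HasAmalgam L (FinAge L M) f g := by
  obtain ⟨D, hD, hβ, hγ, -⟩ := exists_extension (σ.toEmbedding.comp β) γ
  refine ⟨Bundled.of D, ⟨hD, ⟨D.subtype⟩⟩, (σ.toEmbedding.comp β).codRestrict D hβ,
    γ.codRestrict D hγ, fun x => Subtype.ext (h x)⟩

/-- If all types in the arities of the homogenizing formulas are witnessed by tuples of bounded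
length, then the age satisfies SEAP. -/
theorem Homogenizes.seap [L.IsRelational] {n : ℕ} {k : Fin n → ℕ}
    {φ : ∀ i : Fin n, L.Formula (Fin (k i))} (h : Homogenizes L M φ) {m : ℕ}
    (hw : ∀ i (a : Fin (k i) → M), ∃ (κ : Type) (_ : Finite κ) (w : κ → M),
      Nat.card κ ≤ m ∧ Witnesses L a w) : SEAP L (FinAge L M) := by
  refine ⟨(∑ i, k i) + 1, m + 1, ?_⟩
  rintro A B C ⟨hA, -⟩ ⟨hB, ⟨β⟩⟩ ⟨hC, ⟨γ⟩⟩ f g hfg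
  obtain ⟨i, t, ht⟩ : ∃ i, ∃ t : Fin (k i) → A,
      ¬ SameType L M (β ∘ f ∘ t) (γ ∘ g ∘ t) := by
    by_contra! hcon
    obtain ⟨σ, hσ⟩ := h.exists_equiv (a := β ∘ f) (b := γ ∘ g)
      ⟨(SameAtomicDiagram.of_embedding (β.comp f) id).symm.trans
        (.of_embedding (γ.comp g) id), fun i t => hcon i t (φ i)⟩
    exact hfg (hasAmalgam_of_equiv β γ σ hσ)
  obtain ⟨κ, hκ, w, hκm, hwit⟩ := hw i (β ∘ f ∘ t)
  obtain ⟨κ', hκ', w', hκm', hwit'⟩ := hw i (γ ∘ g ∘ t)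
  obtain ⟨B0, hB0, hβ, hwB, hcard⟩ := exists_extension β w
  obtain ⟨C0, hC0, hγ, hwC, hcard'⟩ := exists_extension γ w'
  have hA0 := Substructure.closure_eq_of_isRelational L (Set.range t)
  refine ⟨Substructure.closure L (Set.range t), ?_, Bundled.of B0, ⟨hB0, ⟨B0.subtype⟩⟩,
    Bundled.of C0, ⟨hC0, ⟨C0.subtype⟩⟩, β.codRestrict B0 hβ, γ.codRestrict C0 hγ, ?_, ?_, ?_⟩
  · have h1 : Nat.card (Substructure.closure L (Set.range t)) = Nat.card (Set.range t) := by
      conv_rhs => rw [← hA0]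
      rfl
    have h2 : Nat.card (Set.range t) ≤ k i := (Finite.card_range_le t).trans (by simp)
    have h3 : k i ≤ ∑ i, k i := Finset.single_le_sum (fun _ _ => Nat.zero_le _) (Finset.mem_univ i)
    omega
  · change Nat.card B0 - Nat.card B < m + 1
    omega
  · change Nat.card C0 - Nat.card C < m + 1
    omega
  · rintro ⟨D, ⟨-, ⟨δ⟩⟩, f0, g0, hD⟩
    have h1 := hwit.sameType_embedding (fun i => hβ _) hwB (δ.comp f0)
    have h2 := hwit'.sameType_embedding (fun i => hγ _) hwC (δ.comp g0)
    refine ht (h1.trans (SameType.symm ?_))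
    convert h2 using 1
    funext l
    exact congrArg δ (hD ⟨t l, Substructure.subset_closure ⟨l, rfl⟩⟩)

end

/-- A homogenizable model-complete structure is `Σ₁`-homogenizable, with all
types isolated by a conjunction of the homogenizing formulas and quantifier-free formulas,
and its age satisfies SEAP. -/
theorem homogenizable_modelComplete_seap
    (L : FirstOrder.Language.{0, 0}) [L.IsRelational] [Finite (Σ n : ℕ, L.Relations n)]
    (M : Type) [L.Structure M]
    (hhom : Homogenizable L M) (hmc : ModelComplete L M) :
    Sigma1Homogenizable L M ∧
    (∃ (n : ℕ) (k : Fin n → ℕ) (φ : ∀ i : Fin n, L.Formula (Fin (k i))),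
      (∀ i, IsSigma1 L (φ i)) ∧ Homogenizes L M φ ∧
      ∀ (p : ℕ) (a : Fin p → M), IsolatedByHomConj L M φ a) ∧
    SEAP L (FinAge L M) := by
  obtain ⟨n, k, φ, hφ⟩ := hhom
  choose J hJ r hr using fun p => hφ.exists_finite_representatives p
  choose κ hκ w hw using fun p (j : J p) => hmc.exists_witnesses (hr p) (r p j)
  choose θ hθ hθr hθw using fun p (j : J p) => (hw p j).exists_isSigma1
  let I : Type := Σ i : Fin n, J (k i)
  obtain ⟨N, ⟨e⟩⟩ := Finite.exists_equiv_fin I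
  let k' : Fin N → ℕ := fun x => k (e.symm x).1
  let φ' : ∀ x, L.Formula (Fin (k' x)) := fun x => θ _ (e.symm x).2
  have hφ'r : ∀ x b, (φ' x).Realize b ↔ SameType L M (r _ (e.symm x).2) b :=
    fun x b => hθr _ _ b
  have hφ'σ : ∀ x, IsSigma1 L (φ' x) := fun x => hθ _ _
  have htype : ∀ (ι : Type) (a b : ι → M),
      (∀ x (t : Fin (k' x) → ι), (φ' x).Realize (a ∘ t) → (φ' x).Realize (b ∘ t)) →
      ∀ i (t : Fin (k i) → ι), SameType L M (a ∘ t) (b ∘ t) := by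
    intro ι a b hab i t
    obtain ⟨j, hj⟩ := hr _ (a ∘ t)
    obtain ⟨x, hx⟩ := e.symm.surjective ⟨i, j⟩
    have key : ∀ y : I, y = e.symm x → ∀ t : Fin (k y.1) → ι,
        SameType L M (r _ y.2) (a ∘ t) → SameType L M (r _ y.2) (b ∘ t) := by
      rintro _ rfl t' ht'
      exact (hφ'r x _).1 (hab x t' ((hφ'r x _).2 ht'))
    exact hj.symm.trans (key ⟨i, j⟩ hx.symm t hj)
  have hhom' : Homogenizes L M φ' := homogenizes_of_exists_equiv fun ι _ a b hab =>
    hφ.exists_equiv ⟨hab.1, fun i t => htype ι a b (fun x t => (hab.2 x t).1) i t (φ i)⟩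
  refine ⟨⟨N, k', φ', hφ'σ, hhom'⟩, ⟨N, k', φ', hφ'σ, hhom', fun p a => ?_⟩, ?_⟩
  · obtain ⟨χ, hχ, hχr⟩ := exists_isQF_realize_iff_sameAtomicDiagram (L := L) a
    have hfin : {t : Σ x : Fin N, Fin (k' x) → Fin p |
        ((φ' t.1).relabel t.2).Realize a}.Finite := Set.toFinite _
    refine ⟨χ, hχ, hfin.toFinset.toList,
      ⟨(hχr a).2 ⟨fun _ _ => Iff.rfl, fun _ _ => Iff.rfl⟩, fun t ht => ?_⟩, fun b hb => ?_⟩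
    · simpa using ht
    · refine hφ.sameType ⟨(hχr b).1 hb.1, fun i t => htype _ a b (fun x t hx => ?_) i t (φ i)⟩
      refine Formula.realize_relabel.1 (hb.2 ⟨x, t⟩ ?_)
      simpa using hx
  · obtain ⟨m, hm⟩ : ∃ m, ∀ y : I, Nat.card (κ _ y.2) ≤ m :=
      (Set.finite_range fun y : I => Nat.card (κ _ y.2)).bddAbove.imp
        fun m hm y => hm ⟨y, rfl⟩
    refine hφ.seap (m := m) fun i a => ?_
    obtain ⟨j, hj⟩ := hr _ a
    obtain ⟨w', hw'⟩ := hθw _ j a hj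
    exact ⟨_, hκ _ j, w', hm ⟨i, j⟩, hw'⟩

end HomPaper
end
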